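/- arXiv:2306.07452 — 3 statements merged into one kernel-verified Lean document; each statement's English description precedes it below -/
import Mathlib

section
/- (Blaschke–Privalov criterion) Let Ω ⊂ ℝ^m be a domain and let u be an upper semicontinuous function on Ω, not identically -∞. Then u is subharmonic on Ω if and only if Δ̄u(x) ≥ 0 for every x ∈ Ω with u(x) ≠ -∞. -/
open MeasureTheory Metric Filter Topology Set
open scoped ENNReal

noncomputable section

/-- The positive part of an extended real number, as an extended nonnegative real. -/
def erealToENNReal (x : EReal) : ℝ≥0∞ := if x = ⊤ then ⊤ else ENNReal.ofReal x.toReal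

variable {E : Type*} [NormedAddCommGroup E] [MeasureSpace E]

/-- The mean value `M_u(x,r)` of an extended-real-valued function `u` over the ball `B(x,r)`,
computed as the difference of the integrals of the positive and negative parts. -/
def erealBallAvg (u : E → EReal) (x : E) (r : ℝ) : EReal :=
  (((∫⁻ y in ball x r, erealToENNReal (u y)) / volume (ball x r) : ℝ≥0∞) : EReal)
    - (((∫⁻ y in ball x r, erealToENNReal (-(u y))) / volume (ball x r) : ℝ≥0∞) : EReal)

/-- The sub-mean value property on a set `s`: at each point of `s` the value of `u` is at most
its average over every sufficiently small ball centered at the point and contained in `s`. -/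
def SubmeanOn (u : E → EReal) (s : Set E) : Prop :=
  ∀ x ∈ s, ∃ R > 0, ∀ r : ℝ, 0 < r → r < R → closedBall x r ⊆ s →
    u x ≤ erealBallAvg u x r

/-- `u : E → [-∞,∞)` is subharmonic on `s` if it is upper semicontinuous on `s`, not
identically `-∞` on `s`, takes values in `[-∞,∞)`, and satisfies the sub-mean value
inequality on `s`. -/
def IsSubharmonicOn (u : E → EReal) (s : Set E) : Prop :=
  UpperSemicontinuousOn u s ∧ (¬ ∀ x ∈ s, u x = ⊥) ∧ (∀ x ∈ s, u x < ⊤) ∧ SubmeanOn u s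

/-- The generalized upper Laplace parameter (upper Privalov operator)
`Δ̄u(x) = 2(m+2) · limsup_{r→0⁺} (M_u(x,r) - u(x))/r²`. -/
def upperLaplace (m : ℕ) (u : E → EReal) (x : E) : EReal :=
  ((2 * ((m : ℝ) + 2) : ℝ) : EReal) *
    Filter.limsup (fun r : ℝ => (((r ^ 2)⁻¹ : ℝ) : EReal) * (erealBallAvg u x r - u x))
      (𝓝[>] (0 : ℝ))

section SupConv

variable {V : Type*} [NormedAddCommGroup V]

/-- The sup-convolution of `b` with the cone of slope `n`. -/
def supConv (b : V → ℝ) (n : ℝ) (x : V) : ℝ := ⨆ y, (b y - n * dist x y)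

variable {b : V → ℝ} {M n : ℝ}

lemma bddAbove_supConv (hM : ∀ x, b x ≤ M) (hn : 0 ≤ n) (x : V) :
    BddAbove (range fun y => b y - n * dist x y) :=
  ⟨M, by rintro _ ⟨y, rfl⟩; have := hM y; have : 0 ≤ n * dist x y := by positivity
         dsimp only; linarith⟩

lemma le_supConv' (hM : ∀ x, b x ≤ M) (hn : 0 ≤ n) (x y : V) :
    b y - n * dist x y ≤ supConv b n x :=
  le_ciSup (bddAbove_supConv hM hn x) y

lemma le_supConv (hM : ∀ x, b x ≤ M) (hn : 0 ≤ n) (x : V) : b x ≤ supConv b n x := by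
  simpa using le_supConv' hM hn x x

lemma supConv_le (hM : ∀ x, b x ≤ M) (hn : 0 ≤ n) (x : V) : supConv b n x ≤ M :=
  ciSup_le fun y => by
    have := hM y
    have : 0 ≤ n * dist x y := by positivity
    linarith

lemma continuous_supConv (hM : ∀ x, b x ≤ M) (hn : 0 ≤ n) : Continuous (supConv b n) := by
  refine (LipschitzWith.of_le_add_mul n.toNNReal fun x x' => ciSup_le fun y => ?_).continuous
  have := le_supConv' hM hn x' y
  rw [Real.coe_toNNReal _ hn]
  change _ ≤ supConv b n x' + _
  nlinarith [dist_triangle x' x y, dist_comm x x']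

lemma exists_supConv_eq [ProperSpace V] (hb : UpperSemicontinuous b) (h0 : ∀ x, 0 ≤ b x)
    (hM : ∀ x, b x ≤ M) (hn : 1 ≤ n) (x : V) :
    ∃ y, dist x y ≤ M ∧ supConv b n x = b y - n * dist x y := by
  have hM0 : 0 ≤ M := (h0 x).trans (hM x)
  have husc : UpperSemicontinuous fun y => b y - n * dist x y := by
    have : Continuous fun y => -(n * dist x y) := by fun_prop
    simpa [sub_eq_add_neg] using hb.add this.upperSemicontinuous
  obtain ⟨y, hy, hmax⟩ := (husc.upperSemicontinuousOn (closedBall x M)).exists_isMaxOn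
    ⟨x, mem_closedBall_self hM0⟩ (isCompact_closedBall x M)
  refine ⟨y, by rw [dist_comm]; exact hy, le_antisymm (ciSup_le fun z => ?_)
    (le_supConv' hM (zero_le_one.trans hn) x y)⟩
  by_cases hz : z ∈ closedBall x M
  · exact hmax hz
  · have h1 : b x - n * dist x x ≤ b y - n * dist x y := hmax (mem_closedBall_self hM0)
    rw [mem_closedBall, dist_comm, not_le] at hz
    rw [dist_self, mul_zero, sub_zero] at h1
    have h2 := h0 x
    have h3 := hM z
    nlinarith

lemma hasCompactSupport_supConv [ProperSpace V] (hb : UpperSemicontinuous b) (h0 : ∀ x, 0 ≤ b x)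
    (hM : ∀ x, b x ≤ M) (hn : 1 ≤ n) (hcs : HasCompactSupport b) :
    HasCompactSupport (supConv b n) := by
  refine HasCompactSupport.intro (hcs.isCompact.cthickening (r := M)) fun x hx => ?_
  obtain ⟨y, hy, heq⟩ := exists_supConv_eq hb h0 hM hn x
  have h1 : b y = 0 := by
    by_contra h
    exact hx (mem_cthickening_of_dist_le x y M _ (subset_tsupport b h) hy)
  have h2 := (h0 x).trans (le_supConv hM (zero_le_one.trans hn) x)
  have h3 : 0 ≤ n * dist x y := by positivity
  linarith

lemma tendsto_supConv [ProperSpace V] (hb : UpperSemicontinuous b) (h0 : ∀ x, 0 ≤ b x)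
    (hM : ∀ x, b x ≤ M) (x : V) :
    Tendsto (fun n : ℕ => supConv b (n + 1) x) atTop (𝓝 (b x)) := by
  refine tendsto_order.2 ⟨fun a ha => Eventually.of_forall fun n =>
    ha.trans_le (le_supConv hM (by positivity) x), fun a ha => ?_⟩
  obtain ⟨δ, hδ, hball⟩ := Metric.eventually_nhds_iff_ball.1 (hb x a ha)
  obtain ⟨N, hN⟩ := exists_nat_gt (M / δ)
  refine (eventually_ge_atTop N).mono fun n hn => ?_
  obtain ⟨y, hy, heq⟩ := exists_supConv_eq hb h0 hM
    (show (1 : ℝ) ≤ n + 1 by linarith [n.cast_nonneg (α := ℝ)]) x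
  have h2 : 0 ≤ ((n : ℝ) + 1) * dist x y := by positivity
  rcases lt_or_ge (dist x y) δ with h | h
  · have := hball y (by rwa [mem_ball, dist_comm])
    linarith
  · exfalso
    have h1 := (h0 x).trans (le_supConv hM (show (0 : ℝ) ≤ n + 1 by positivity) x)
    have h3 := hM y
    have h4 : M < n * δ := by
      rw [div_lt_iff₀ hδ] at hN
      exact hN.trans_le (by gcongr)
    have h5 : n * δ ≤ ((n : ℝ) + 1) * dist x y := by gcongr; linarith
    linarith

end SupConv

section Schwartz

open scoped ContDiff NNReal Laplacian InnerProductSpace SchwartzMap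

variable {V : Type*} [NormedAddCommGroup V] [InnerProductSpace ℝ V]

lemma exists_schwartzMap_complex_sub_smul_laplacian_eq [FiniteDimensional ℝ V] {t : ℝ}
    (ht : 0 < t) (φ : 𝓢(V, ℂ)) : ∃ w : 𝓢(V, ℂ), w - t • Δ w = φ := by
  borelize V
  set s : ℝ := 2 * Real.pi * √t
  set h : V → ℝ := fun x => (1 + ‖s • x‖ ^ 2) ^ (-1 : ℝ)
  have hh : h.HasTemperateGrowth :=
    (Function.hasTemperateGrowth_one_add_norm_sq_rpow V (-1)).comp
      (s • ContinuousLinearMap.id ℝ V).hasTemperateGrowth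
  have hn : (fun x : V => ‖x‖ ^ 2).HasTemperateGrowth := by fun_prop
  have hc : (fun x : V => (2 * Real.pi) ^ 2 * t * ‖x‖ ^ 2).HasTemperateGrowth := by fun_prop
  refine ⟨SchwartzMap.fourierMultiplierCLM ℂ h φ, ?_⟩
  have hsum := SchwartzMap.fourierMultiplierCLM_sum (F := ℂ) (s := (Finset.univ : Finset (Fin 2)))
    (g := ![h, fun x => (2 * Real.pi) ^ 2 * t * ‖x‖ ^ 2 * h x])
    (by intro i _; fin_cases i; exacts [hh, hc.mul hh])
  have hone : (fun x => ∑ i : Fin 2,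
      (![h, fun x => (2 * Real.pi) ^ 2 * t * ‖x‖ ^ 2 * h x] : Fin 2 → V → ℝ) i x)
      = fun _ => (1 : ℝ) := by
    ext x
    have hpos : 0 < 1 + ‖s • x‖ ^ 2 := by positivity
    have : ‖s • x‖ ^ 2 = (2 * Real.pi) ^ 2 * t * ‖x‖ ^ 2 := by
      rw [norm_smul, mul_pow, Real.norm_eq_abs, sq_abs, mul_pow, Real.sq_sqrt ht.le]
    simp only [Fin.sum_univ_two, Matrix.cons_val_zero, Matrix.cons_val_one, h, Real.rpow_neg_one]
    rw [← this]
    field_simp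
  rw [hone, SchwartzMap.fourierMultiplierCLM_const] at hsum
  have h2 := congrArg (fun T => T φ) hsum
  simp only [Fin.sum_univ_two, Matrix.cons_val_zero, Matrix.cons_val_one, one_smul,
    ContinuousLinearMap.id_apply, _root_.add_apply] at h2
  rw [SchwartzMap.laplacian_eq_fourierMultiplierCLM,
    SchwartzMap.fourierMultiplierCLM_fourierMultiplierCLM_apply hn hh]
  nth_rewrite 3 [h2]
  have h3 : (fun x => (2 * Real.pi) ^ 2 * t * ‖x‖ ^ 2 * h x)
      = ((2 * Real.pi) ^ 2 * t) • ((fun x : V => ‖x‖ ^ 2) * h) := by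
    ext x; simp [mul_assoc]
  rw [h3, SchwartzMap.fourierMultiplierCLM_smul (hn.mul hh)]
  simp only [neg_smul, smul_neg, sub_neg_eq_add, smul_smul, _root_.smul_apply]
  rw [mul_comm t]

lemma exists_schwartzMap_sub_mul_laplacian_eq [FiniteDimensional ℝ V] {t : ℝ} (ht : 0 < t)
    (φ : 𝓢(V, ℝ)) : ∃ w : 𝓢(V, ℝ), ∀ x, w x - t * (Δ (w : V → ℝ)) x = φ x := by
  obtain ⟨w, hw⟩ := exists_schwartzMap_complex_sub_smul_laplacian_eq ht
    (φ.postcompCLM Complex.ofRealCLM)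
  refine ⟨w.postcompCLM Complex.reCLM, fun x => ?_⟩
  have h1 : ⇑(w.postcompCLM Complex.reCLM) = Complex.reCLM ∘ w := by ext y; simp
  have h2 := congrArg (fun f : 𝓢(V, ℂ) => (f x).re) hw
  rw [h1, ((w.smooth 2).contDiffAt).laplacian_CLM_comp_left]
  simpa [SchwartzMap.laplacian_apply] using h2

lemma SchwartzMap.exists_lipschitzWith_fderiv (w : 𝓢(V, ℝ)) :
    ∃ C, LipschitzWith C (fderiv ℝ w) := by
  have h1 : ⇑(SchwartzMap.fderivCLM ℝ V ℝ w) = fderiv ℝ w := by ext1 x; simp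
  set g := SchwartzMap.fderivCLM ℝ V ℝ w
  obtain ⟨C, -, hC⟩ := (SchwartzMap.fderivCLM ℝ V _ g).decay 0 0
  refine ⟨C.toNNReal, ?_⟩
  rw [← h1]
  refine lipschitzWith_of_nnnorm_fderiv_le g.differentiable fun x => ?_
  rw [← NNReal.coe_le_coe, coe_nnnorm]
  have := hC x
  simp only [pow_zero, norm_iteratedFDeriv_zero, one_mul, SchwartzMap.fderivCLM_apply] at this
  exact this.trans (Real.le_coe_toNNReal C)

lemma SchwartzMap.exists_abs_laplacian_le [FiniteDimensional ℝ V] (w : 𝓢(V, ℝ)) :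
    ∃ K, 0 ≤ K ∧ ∀ x, |(Δ (w : V → ℝ)) x| ≤ K := by
  obtain ⟨K, hK0, hK⟩ := (Δ w).decay 0 0
  exact ⟨K, hK0.le, fun x => by simpa [SchwartzMap.laplacian_apply] using hK x⟩

/-- Uniform approximation of a compactly supported continuous function by Schwartz functions. -/
lemma exists_schwartzMap_abs_sub_le [FiniteDimensional ℝ V] {b : V → ℝ} (hb : Continuous b)
    (hcs : HasCompactSupport b) {ε : ℝ} (hε : 0 < ε) : ∃ φ : 𝓢(V, ℝ), ∀ x, |φ x - b x| ≤ ε := by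
  obtain ⟨δ, hδ, hδb⟩ := Metric.uniformContinuous_iff.1
    (hcs.uniformContinuous_of_continuous hb) ε hε
  obtain ⟨g, hg, hgb⟩ := hb.exists_contDiff_dist_le_of_forall_mem_ball_dist_le hδ
  have hgc : HasCompactSupport g := by
    refine HasCompactSupport.intro (hcs.isCompact.cthickening (r := δ)) fun x hx => ?_
    have hzero (y : V) (hy : y ∈ ball x δ) : b y = 0 := by
      by_contra h
      refine hx (mem_cthickening_of_dist_le x y δ _ (subset_tsupport b h) ?_)
      rw [dist_comm]; exact (mem_ball.1 hy).le
    have := hgb x 0 fun y hy => by simp [hzero y hy, hzero x (mem_ball_self hδ)]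
    rw [hzero x (mem_ball_self hδ)] at this
    exact dist_le_zero.1 this
  refine ⟨hgc.toSchwartzMap hg, fun x => ?_⟩
  exact hgb x ε fun y hy => (hδb hy).le

end Schwartz

section BallMeans

open scoped ContDiff NNReal Laplacian InnerProductSpace SchwartzMap

variable {V : Type*} [NormedAddCommGroup V]

/-- The function `(1 - ‖y‖²)₊ / 2`, whose gradient on the unit ball is `-y`. -/
def paraboloid (y : V) : ℝ := max (1 - ‖y‖ ^ 2) 0 / 2

lemma paraboloid_nonneg (y : V) : 0 ≤ paraboloid y := by unfold paraboloid; positivity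

lemma paraboloid_eq_zero {y : V} (hy : 1 ≤ ‖y‖) : paraboloid y = 0 := by
  have : 1 - ‖y‖ ^ 2 ≤ 0 := by nlinarith
  simp [paraboloid, max_eq_right this]

lemma paraboloid_eq {y : V} (hy : ‖y‖ ≤ 1) : paraboloid y = (1 - ‖y‖ ^ 2) / 2 := by
  have : 0 ≤ 1 - ‖y‖ ^ 2 := by nlinarith [norm_nonneg y]
  simp [paraboloid, max_eq_left this]

lemma hasCompactSupport_paraboloid [ProperSpace V] : HasCompactSupport (paraboloid : V → ℝ) :=
  HasCompactSupport.intro (isCompact_closedBall 0 1) fun y hy => by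
    simp only [mem_closedBall, dist_zero_right, not_le] at hy
    exact paraboloid_eq_zero hy.le

lemma lipschitzWith_paraboloid : LipschitzWith 1 (paraboloid : V → ℝ) := by
  have key (y : V) : paraboloid y = (1 - min ‖y‖ 1 ^ 2) / 2 := by
    rcases le_total ‖y‖ 1 with h | h
    · rw [paraboloid_eq h, min_eq_left h]
    · rw [paraboloid_eq_zero h, min_eq_right h]; norm_num
  refine LipschitzWith.of_dist_le_mul fun y z => ?_
  have h1 : |min ‖y‖ 1 - min ‖z‖ 1| ≤ dist y z :=
    ((abs_min_sub_min_le_max _ _ _ _).trans (by simp)).trans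
      ((abs_norm_sub_norm_le y z).trans_eq (dist_eq_norm y z).symm)
  have hy : 0 ≤ min ‖y‖ 1 := by positivity
  have hz : 0 ≤ min ‖z‖ 1 := by positivity
  have hy' : min ‖y‖ 1 ≤ 1 := min_le_right _ _
  have hz' : min ‖z‖ 1 ≤ 1 := min_le_right _ _
  rw [Real.dist_eq, key, key, NNReal.coe_one, one_mul]
  refine le_trans ?_ h1
  rw [show (1 - min ‖y‖ 1 ^ 2) / 2 - (1 - min ‖z‖ 1 ^ 2) / 2
    = -(min ‖y‖ 1 - min ‖z‖ 1) * ((min ‖y‖ 1 + min ‖z‖ 1) / 2) by ring, abs_mul, abs_neg]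
  refine mul_le_of_le_one_right (abs_nonneg _) ?_
  rw [abs_le]; constructor <;> linarith

variable [InnerProductSpace ℝ V]

lemma lineDeriv_paraboloid_of_lt {y : V} (hy : ‖y‖ < 1) (v : V) :
    lineDeriv ℝ paraboloid y v = -⟪y, v⟫_ℝ := by
  have h1 : paraboloid =ᶠ[𝓝 y] fun z : V => (1 - ‖z‖ ^ 2) / 2 := by
    filter_upwards [continuous_norm.continuousAt.eventually_lt continuousAt_const hy] with z hz
    exact paraboloid_eq (le_of_lt hz)
  rw [h1.lineDeriv_eq]
  have h2 := (((hasStrictFDerivAt_norm_sq y).hasFDerivAt.const_sub 1).const_mul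
    (2 : ℝ)⁻¹).hasLineDerivAt v
  have h3 : (fun z : V => (1 - ‖z‖ ^ 2) / 2) = fun z => (2 : ℝ)⁻¹ * (1 - ‖z‖ ^ 2) := by
    ext z; ring
  rw [h3, h2.lineDeriv]
  simp

lemma lineDeriv_paraboloid_of_gt {y : V} (hy : 1 < ‖y‖) (v : V) :
    lineDeriv ℝ paraboloid y v = 0 := by
  have h1 : paraboloid =ᶠ[𝓝 y] fun _ : V => (0 : ℝ) := by
    filter_upwards [continuousAt_const.eventually_lt continuous_norm.continuousAt hy] with z hz
    exact paraboloid_eq_zero (le_of_lt hz)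
  rw [h1.lineDeriv_eq]
  simp [lineDeriv]

variable [FiniteDimensional ℝ V]

lemma sum_inner_mul_eq_apply (e : V →L[ℝ] ℝ) (y : V) :
    ∑ i, ⟪y, stdOrthonormalBasis ℝ V i⟫_ℝ * e (stdOrthonormalBasis ℝ V i) = e y := by
  conv_rhs => rw [← (stdOrthonormalBasis ℝ V).sum_repr' y]
  simp [real_inner_comm]

variable [MeasurableSpace V] (μ : Measure V) [μ.IsAddHaarMeasure]

lemma measureReal_ball_pos (x : V) {r : ℝ} (hr : 0 < r) : 0 < μ.real (ball x r) :=
  ENNReal.toReal_pos (measure_ball_pos μ x hr).ne' measure_ball_lt_top.ne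

variable [BorelSpace V]

lemma setIntegral_inner_mul_eq {h : V → ℝ} {C : ℝ≥0} (hC : LipschitzWith C h)
    (hd : Differentiable ℝ h) (v : V) :
    ∫ y in ball (0 : V) 1, ⟪y, v⟫_ℝ * h y ∂μ = ∫ y, paraboloid y * fderiv ℝ h y v ∂μ := by
  have := LipschitzWith.integral_lineDeriv_mul_eq (μ := μ) hC lipschitzWith_paraboloid
    hasCompactSupport_paraboloid v
  calc _ = ∫ y, lineDeriv ℝ paraboloid y (-v) * h y ∂μ := by
        rw [← integral_indicator measurableSet_ball]
        refine integral_congr_ae ?_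
        have hs : ∀ᵐ y ∂μ, y ∉ sphere (0 : V) 1 :=
          measure_eq_zero_iff_ae_notMem.1 (Measure.addHaar_sphere_of_ne_zero μ 0 one_ne_zero)
        filter_upwards [hs] with y hy
        simp only [mem_sphere_iff_norm, sub_zero] at hy
        rcases lt_or_gt_of_ne hy with h1 | h1
        · rw [indicator_of_mem (by simpa using h1), lineDeriv_paraboloid_of_lt h1]; simp
        · rw [indicator_of_notMem (by simpa using h1.le), lineDeriv_paraboloid_of_gt h1]; simp
    _ = _ := by
        rw [← this]
        exact integral_congr_ae (Eventually.of_forall fun y => by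
          simp only [(hd y).lineDeriv_eq_fderiv, mul_comm])

lemma setIntegral_fderiv_apply_eq {w : V → ℝ} {C : ℝ≥0} (hw : ContDiff ℝ 2 w)
    (hC : LipschitzWith C (fderiv ℝ w)) (x : V) (r : ℝ) :
    ∫ y in ball (0 : V) 1, fderiv ℝ w (x + r • y) y ∂μ
      = r * ∫ y, paraboloid y * (Δ w) (x + r • y) ∂μ := by
  set b := stdOrthonormalBasis ℝ V
  have hD : Differentiable ℝ (fderiv ℝ w) :=
    (hw.fderiv_right (m := 1) (by norm_num)).differentiable (by norm_num)
  have hcD : Continuous (fderiv ℝ w) := hD.continuous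
  have hcDD : Continuous (fderiv ℝ (fderiv ℝ w)) :=
    (hw.fderiv_right (m := 1) (by norm_num)).continuous_fderiv (by norm_num)
  have hi (i) : ∫ y in ball (0 : V) 1, ⟪y, b i⟫_ℝ * fderiv ℝ w (x + r • y) (b i) ∂μ
      = ∫ y, paraboloid y * (r * fderiv ℝ (fderiv ℝ w) (x + r • y) (b i) (b i)) ∂μ := by
    have hder (y : V) : HasFDerivAt (fun y => fderiv ℝ w (x + r • y) (b i))
        ((ContinuousLinearMap.apply ℝ ℝ (b i)).comp ((fderiv ℝ (fderiv ℝ w) (x + r • y)).comp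
          (r • ContinuousLinearMap.id ℝ V))) y := by
      have h1 : HasFDerivAt (fun y : V => x + r • y) (r • ContinuousLinearMap.id ℝ V) y :=
        ((hasFDerivAt_id y).const_smul r).const_add x
      exact (ContinuousLinearMap.apply ℝ ℝ (b i)).hasFDerivAt.comp y
        ((hD _).hasFDerivAt.comp y h1)
    have hL : LipschitzWith (C * ‖r‖₊) (fun y => fderiv ℝ w (x + r • y) (b i)) := by
      refine LipschitzWith.of_dist_le_mul fun y z => ?_
      rw [Real.dist_eq, ← _root_.sub_apply]
      refine (ContinuousLinearMap.le_opNorm (fderiv ℝ w (x + r • y) - fderiv ℝ w (x + r • z))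
        (b i)).trans ?_
      rw [b.orthonormal.1, mul_one, ← dist_eq_norm]
      refine (hC.dist_le_mul _ _).trans_eq ?_
      simp [dist_smul₀, mul_assoc]
    rw [setIntegral_inner_mul_eq μ hL (fun y => (hder y).differentiableAt)]
    refine integral_congr_ae (Eventually.of_forall fun y => ?_)
    simp [(hder y).fderiv]
  have hL (z : V) : (Δ w) z = ∑ i, fderiv ℝ (fderiv ℝ w) z (b i) (b i) := by
    rw [InnerProductSpace.laplacian_eq_iteratedFDeriv_orthonormalBasis w b]
    simp [iteratedFDeriv_two_apply]
  have hcs (g : V → ℝ) (hg : Continuous g) : Integrable (fun y => paraboloid y * g y) μ :=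
    (lipschitzWith_paraboloid.continuous.mul hg).integrable_of_hasCompactSupport
      hasCompactSupport_paraboloid.mul_right
  calc _ = ∫ y in ball (0 : V) 1, ∑ i, ⟪y, b i⟫_ℝ * fderiv ℝ w (x + r • y) (b i) ∂μ := by
        simp_rw [b, sum_inner_mul_eq_apply]
    _ = ∑ i, ∫ y in ball (0 : V) 1, ⟪y, b i⟫_ℝ * fderiv ℝ w (x + r • y) (b i) ∂μ := by
        refine integral_finsetSum _ fun i _ => ?_
        refine IntegrableOn.mono_set ?_ (ball_subset_closedBall (x := (0 : V)))
        exact (Continuous.continuousOn (by fun_prop)).integrableOn_compact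
          (isCompact_closedBall _ _)
    _ = ∑ i, ∫ y, paraboloid y * (r * fderiv ℝ (fderiv ℝ w) (x + r • y) (b i) (b i)) ∂μ := by
        simp_rw [hi]
    _ = ∫ y, ∑ i, paraboloid y * (r * fderiv ℝ (fderiv ℝ w) (x + r • y) (b i) (b i)) ∂μ := by
        rw [integral_finsetSum _ fun i _ => ?_]
        exact hcs _ (by fun_prop)
    _ = _ := by
        rw [← integral_const_mul]
        refine integral_congr_ae (Eventually.of_forall fun y => ?_)
        simp only [hL, Finset.mul_sum]
        exact Finset.sum_congr rfl fun i _ => by ring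

lemma setAverage_ball_eq (f : V → ℝ) (x : V) {r : ℝ} (hr : 0 < r) :
    ⨍ y in ball x r, f y ∂μ = ⨍ y in ball (0 : V) 1, f (x + r • y) ∂μ := by
  have h1 : ∫ y in ball (0 : V) 1, f (x + r • y) ∂μ
      = (r ^ Module.finrank ℝ V)⁻¹ * ∫ y in ball x r, f y ∂μ := by
    rw [Measure.setIntegral_comp_smul_of_pos μ (fun y => f (x + y)) _ hr, smul_unitBall_of_pos hr,
      smul_eq_mul]
    congr 1
    have := (measurePreserving_add_left μ x).setIntegral_preimage_emb
      (measurableEmbedding_addLeft x) f (ball x r)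
    rw [← this]
    congr 2
    ext y
    simp
  have h2 : μ.real (ball x r) = r ^ Module.finrank ℝ V * μ.real (ball (0 : V) 1) := by
    rw [measureReal_def, Measure.addHaar_ball_of_pos μ x hr, ENNReal.toReal_mul,
      ENNReal.toReal_ofReal (by positivity), measureReal_def]
  have := measureReal_ball_pos μ (0 : V) one_pos
  rw [setAverage_eq, setAverage_eq, h1, h2, smul_eq_mul, smul_eq_mul]
  field_simp

/-- The mean of `paraboloid` over the unit ball; it relates ball means to the Laplacian. -/
def paraboloidMean : ℝ := (∫ y, paraboloid y ∂μ) / μ.real (ball (0 : V) 1)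

lemma integrable_paraboloid_mul {g : V → ℝ} (hg : Continuous g) :
    Integrable (fun y => paraboloid y * g y) μ :=
  (lipschitzWith_paraboloid.continuous.mul hg).integrable_of_hasCompactSupport
    hasCompactSupport_paraboloid.mul_right

lemma integrable_paraboloid : Integrable (paraboloid : V → ℝ) μ :=
  lipschitzWith_paraboloid.continuous.integrable_of_hasCompactSupport
    hasCompactSupport_paraboloid

lemma paraboloidMean_pos : 0 < paraboloidMean μ := by
  refine div_pos ?_ (measureReal_ball_pos μ 0 one_pos)
  refine Continuous.integral_pos_of_hasCompactSupport_nonneg_nonzero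
    lipschitzWith_paraboloid.continuous hasCompactSupport_paraboloid paraboloid_nonneg (x := 0) ?_
  rw [paraboloid_eq (by simp)]
  simp

lemma hasDerivAt_setIntegral_comp {w : V → ℝ} {C : ℝ≥0} (hw : ContDiff ℝ 2 w)
    (hC : LipschitzWith C (fderiv ℝ w)) (x : V) (r : ℝ) :
    HasDerivAt (fun r : ℝ => ∫ y in ball (0 : V) 1, w (x + r • y) ∂μ)
      (r * ∫ y, paraboloid y * (Δ w) (x + r • y) ∂μ) r := by
  rw [← setIntegral_fderiv_apply_eq μ hw hC]
  have hwd : Differentiable ℝ w := hw.differentiable (by norm_num)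
  have hfd : Continuous (fderiv ℝ w) := hw.continuous_fderiv (by norm_num)
  have hI (g : V → ℝ) (hg : Continuous g) : Integrable g (μ.restrict (ball (0 : V) 1)) :=
    (hg.continuousOn.integrableOn_compact (isCompact_closedBall (0 : V) 1)).mono_set
      ball_subset_closedBall
  have : IsFiniteMeasure (μ.restrict (ball (0 : V) 1)) :=
    ⟨by simpa using measure_ball_lt_top⟩
  refine (hasDerivAt_integral_of_dominated_loc_of_deriv_le (μ := μ.restrict (ball (0 : V) 1))
    (F := fun r y => w (x + r • y)) (F' := fun r y => fderiv ℝ w (x + r • y) y)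
    (bound := fun _ => ‖fderiv ℝ w x‖ + C * (|r| + 1)) (ball_mem_nhds r one_pos)
    (Eventually.of_forall fun s => (hI _ ?_).aestronglyMeasurable) (hI _ ?_)
    (hI _ ?_).aestronglyMeasurable ?_ (integrable_const _) ?_).2
  · exact hwd.continuous.comp (by fun_prop)
  · exact hwd.continuous.comp (by fun_prop)
  · exact (hfd.comp (by fun_prop)).clm_apply continuous_id
  · refine (ae_restrict_mem measurableSet_ball).mono fun y hy s hs => ?_
    have hy' : ‖y‖ ≤ 1 := by simpa using (mem_ball.1 hy).le
    have hs' : |s| ≤ |r| + 1 := by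
      have := abs_sub_abs_le_abs_sub s r
      have h2 : |s - r| < 1 := by simpa [Real.dist_eq] using hs
      linarith
    have h1 : ‖fderiv ℝ w (x + s • y) - fderiv ℝ w x‖ ≤ C * (|r| + 1) := by
      rw [← dist_eq_norm]
      refine (hC.dist_le_mul _ _).trans (mul_le_mul_of_nonneg_left ?_ C.2)
      rw [dist_eq_norm, add_sub_cancel_left, norm_smul, Real.norm_eq_abs]
      nlinarith [abs_nonneg s, norm_nonneg y]
    calc _ ≤ ‖fderiv ℝ w (x + s • y)‖ * ‖y‖ := ContinuousLinearMap.le_opNorm _ _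
      _ ≤ ‖fderiv ℝ w (x + s • y)‖ := mul_le_of_le_one_right (norm_nonneg _) hy'
      _ ≤ _ := by
        have := norm_sub_norm_le (fderiv ℝ w (x + s • y)) (fderiv ℝ w x)
        linarith
  · refine Eventually.of_forall fun y s _ => ?_
    have h1 : HasDerivAt (fun s : ℝ => x + s • y) y s := by
      simpa using ((hasDerivAt_id s).smul_const y).const_add x
    exact (hwd _).hasFDerivAt.comp_hasDerivAt s h1

lemma setAverage_ball_le_of_laplacian_le {w : V → ℝ} {C : ℝ≥0} (hw : ContDiff ℝ 2 w)
    (hC : LipschitzWith C (fderiv ℝ w)) {x : V} {R K : ℝ} (hR : 0 < R)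
    (hK : ∀ y ∈ ball x R, (Δ w) y ≤ K) :
    ⨍ y in ball x R, w y ∂μ ≤ w x + K * paraboloidMean μ / 2 * R ^ 2 := by
  set I := ∫ y, paraboloid y ∂μ
  have hv := measureReal_ball_pos μ (0 : V) one_pos
  have hΔ : Continuous (Δ w) := by
    rw [InnerProductSpace.laplacian_eq_iteratedFDeriv_stdOrthonormalBasis]
    have := hw.continuous_iteratedFDeriv (m := 2) le_rfl
    fun_prop
  have hder (r : ℝ) := (hasDerivAt_setIntegral_comp μ hw hC x r).sub
    (((hasDerivAt_pow 2 r).const_mul (K * I / 2)))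
  have hanti : AntitoneOn ((fun r : ℝ => ∫ y in ball (0 : V) 1, w (x + r • y) ∂μ)
      - fun r => K * I / 2 * r ^ 2) (Icc 0 R) := by
    refine antitoneOn_of_deriv_nonpos (convex_Icc 0 R)
      (fun r _ => (hder r).continuousAt.continuousWithinAt)
      (fun r _ => (hder r).differentiableAt.differentiableWithinAt) fun r hr => ?_
    rw [interior_Icc] at hr
    rw [(hder r).deriv]
    have : ∫ y, paraboloid y * (Δ w) (x + r • y) ∂μ ≤ ∫ y, paraboloid y * K ∂μ := by
      refine integral_mono (integrable_paraboloid_mul μ (hΔ.comp (by fun_prop)))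
        ((integrable_paraboloid μ).mul_const _) fun y => ?_
      rcases lt_or_ge ‖y‖ 1 with hy | hy
      · refine mul_le_mul_of_nonneg_left (hK _ ?_) (paraboloid_nonneg y)
        rw [mem_ball_iff_norm, add_sub_cancel_left, norm_smul, Real.norm_of_nonneg hr.1.le]
        nlinarith [norm_nonneg y, hr.1, hr.2]
      · simp [paraboloid_eq_zero hy]
    rw [integral_mul_const] at this
    have := mul_le_mul_of_nonneg_left this hr.1.le
    simp only [Nat.cast_ofNat, Nat.add_one_sub_one, pow_one]
    linarith
  have := hanti (left_mem_Icc.2 hR.le) (right_mem_Icc.2 hR.le) hR.le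
  simp only [Pi.sub_apply, zero_smul, add_zero, setIntegral_const, smul_eq_mul] at this
  rw [setAverage_ball_eq μ w x hR, setAverage_eq, smul_eq_mul, paraboloidMean, inv_mul_le_iff₀ hv]
  change _ ≤ μ.real (ball 0 1) * (w x + K * (I / μ.real (ball 0 1)) / 2 * R ^ 2)
  have h3 : μ.real (ball 0 1) * (w x + K * (I / μ.real (ball 0 1)) / 2 * R ^ 2)
    = μ.real (ball 0 1) * w x + K * I / 2 * R ^ 2 := by field_simp
  rw [h3]
  linarith

lemma le_setAverage_ball_of_le_laplacian {w : V → ℝ} {C : ℝ≥0} (hw : ContDiff ℝ 2 w)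
    (hC : LipschitzWith C (fderiv ℝ w)) {x : V} {R K : ℝ} (hR : 0 < R)
    (hK : ∀ y ∈ ball x R, K ≤ (Δ w) y) :
    w x + K * paraboloidMean μ / 2 * R ^ 2 ≤ ⨍ y in ball x R, w y ∂μ := by
  have h1 : fderiv ℝ (-w) = -fderiv ℝ w := by ext1 y; simp [fderiv_neg]
  have := setAverage_ball_le_of_laplacian_le μ (w := -w) (C := C) (K := -K) hw.neg
    (by rw [h1]; exact hC.neg) hR
    (fun y hy => by rw [InnerProductSpace.laplacian_neg]; simpa using hK y hy)
  simp only [Pi.neg_apply, average_neg] at this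
  linarith

/-- `UpperLaplaceGE μ b k x` says that the upper limit of `(M_b(x,r) - b x) / r ^ 2` as `r → 0⁺`
is at least `-k`. -/
def UpperLaplaceGE (b : V → ℝ) (k : ℝ) (x : V) : Prop :=
  ∀ ε > 0, ∃ᶠ r in 𝓝[>] (0 : ℝ), b x - (k + ε) * r ^ 2 ≤ ⨍ y in ball x r, b y ∂μ

variable {μ} in
lemma UpperLaplaceGE.neg_le_laplacian {b w : V → ℝ} {c : ℝ} {C : ℝ≥0} {x : V}
    (hx : UpperLaplaceGE μ b (c * paraboloidMean μ / 2) x) (hb : Continuous b)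
    (hw : ContDiff ℝ 2 w) (hC : LipschitzWith C (fderiv ℝ w))
    (hmax : ∀ y, b y - w y ≤ b x - w x) : -c ≤ (Δ w) x := by
  by_contra! hlt
  obtain ⟨K, hK1, hK2⟩ := exists_between hlt
  have hθ := paraboloidMean_pos μ
  have hΔ : Continuous (Δ w) := by
    rw [InnerProductSpace.laplacian_eq_iteratedFDeriv_stdOrthonormalBasis]
    have := hw.continuous_iteratedFDeriv (m := 2) le_rfl
    fun_prop
  obtain ⟨ρ, hρ, hball⟩ := Metric.eventually_nhds_iff_ball.1
    (hΔ.continuousAt.eventually_lt continuousAt_const hK1)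
  have hε : 0 < (-c - K) * paraboloidMean μ / 4 := by
    have : 0 < -c - K := by linarith
    positivity
  obtain ⟨r, hr, hr0, hrρ⟩ := ((hx _ hε).and_eventually
    (Ioo_mem_nhdsGT hρ)).exists
  have h1 := setAverage_ball_le_of_laplacian_le μ hw hC hr0 (K := K) (x := x)
    fun y hy => (hball y (ball_subset_ball hrρ.le hy)).le
  have hI (g : V → ℝ) (hg : Continuous g) : IntegrableOn g (ball x r) μ :=
    (hg.continuousOn.integrableOn_compact (isCompact_closedBall x r)).mono_set
      ball_subset_closedBall
  have h2 : ⨍ y in ball x r, b y ∂μ ≤ ⨍ y in ball x r, w y ∂μ + (b x - w x) := by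
    have hv := measureReal_ball_pos μ x hr0
    have : ∫ y in ball x r, b y ∂μ ≤ ∫ y in ball x r, (w y + (b x - w x)) ∂μ :=
      setIntegral_mono (hI _ hb) (hI _ (hw.continuous.add continuous_const)) fun y => by
        have := hmax y; dsimp only; linarith
    have h3 : ∫ y in ball x r, (w y + (b x - w x)) ∂μ
        = ∫ y in ball x r, w y ∂μ + μ.real (ball x r) * (b x - w x) := by
      rw [integral_add (hI _ hw.continuous) (hI _ continuous_const), setIntegral_const, smul_eq_mul]
    rw [h3] at this
    rw [setAverage_eq, setAverage_eq, smul_eq_mul, smul_eq_mul, inv_mul_le_iff₀ hv, mul_add,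
      mul_inv_cancel_left₀ hv.ne']
    exact this
  have : 0 < (-c - K) * paraboloidMean μ * r ^ 2 := by
    have : 0 < -c - K := by linarith
    positivity
  linarith

/-- The sub-mean value inequality, with an error term, for continuous compactly supported functions
whose upper Laplace parameter is bounded below. -/
lemma Continuous.le_setAverage_ball_add {b : V → ℝ} (hb : Continuous b)
    (hcs : HasCompactSupport b) {c : ℝ} (hc : 0 ≤ c)
    (hL : ∀ x, UpperLaplaceGE μ b (c * paraboloidMean μ / 2) x) (x : V) {R : ℝ} (hR : 0 < R) :
    b x ≤ ⨍ y in ball x R, b y ∂μ + c * paraboloidMean μ / 2 * R ^ 2 := by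
  refine le_of_forall_pos_le_add fun ε hε => ?_
  set θ := paraboloidMean μ
  have hθ : 0 < θ := paraboloidMean_pos μ
  obtain ⟨ψ, hψ⟩ := exists_schwartzMap_abs_sub_le hb hcs (show 0 < ε / 16 by positivity)
  obtain ⟨K, hK0, hK⟩ := ψ.exists_abs_laplacian_le
  obtain ⟨t, ht, htK⟩ : ∃ t : ℝ, 0 < t ∧ t * (K + c) ≤ ε / 16 := by
    refine ⟨ε / 16 / (K + c + 1), by positivity, ?_⟩
    rw [div_mul_eq_mul_div, div_le_iff₀ (by positivity)]
    nlinarith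
  obtain ⟨η, hη, hηε, hηt⟩ : ∃ η : ℝ, 0 < η ∧ η ≤ ε / 16 ∧ 2 * η / t * θ / 2 * R ^ 2 ≤ ε / 16 := by
    refine ⟨min (ε / 16) (ε / 16 * (t / (θ * R ^ 2))), by positivity, min_le_left _ _, ?_⟩
    have := min_le_right (ε / 16) (ε / 16 * (t / (θ * R ^ 2)))
    calc _ = min (ε / 16) (ε / 16 * (t / (θ * R ^ 2))) * (θ * R ^ 2 / t) := by field_simp
      _ ≤ ε / 16 * (t / (θ * R ^ 2)) * (θ * R ^ 2 / t) := by gcongr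
      _ = ε / 16 := by field_simp
  obtain ⟨φ, hφ⟩ := exists_schwartzMap_abs_sub_le hb hcs hη
  obtain ⟨w, hw⟩ := exists_schwartzMap_sub_mul_laplacian_eq ht φ
  obtain ⟨C, hC⟩ := w.exists_lipschitzWith_fderiv
  have hlow (y : V) : b y - w y ≤ t * c + η := by
    by_contra! hlt
    have hpos : 0 < b y - w y := lt_of_le_of_lt (by positivity) hlt
    have htend : Tendsto (fun z => b z - w z) (cocompact V) (𝓝 0) := by
      simpa using hcs.is_zero_at_infty.sub w.tendsto_cocompact
    obtain ⟨z, hz⟩ := (hb.sub w.continuous).exists_forall_ge' y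
      ((htend.eventually_lt_const hpos).mono fun _ h => le_of_lt h)
    have h1 := (hL z).neg_le_laplacian hb (w.smooth 2) hC hz
    have h2 := hw z
    have h3 := abs_le.1 (hφ z)
    have h4 := hz y
    simp only [Pi.sub_apply] at h4
    nlinarith
  have hup (y : V) : w y - ψ y ≤ ε / 16 + η + t * K := by
    by_contra! hlt
    have hpos : 0 < w y - ψ y := lt_of_le_of_lt (by positivity) hlt
    have htend : Tendsto (fun z => w z - ψ z) (cocompact V) (𝓝 0) := by
      simpa using w.tendsto_cocompact.sub ψ.tendsto_cocompact
    obtain ⟨z, hz⟩ := (w.continuous.sub ψ.continuous).exists_forall_ge' y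
      ((htend.eventually_lt_const hpos).mono fun _ h => le_of_lt h)
    obtain ⟨D, hD⟩ := (ψ - w).exists_lipschitzWith_fderiv
    have h0 : UpperLaplaceGE μ (fun _ => 0) (0 * paraboloidMean μ / 2) z := by
      intro δ hδ
      refine (Eventually.of_forall fun r => ?_).frequently
      simp only [average_zero]
      nlinarith [mul_nonneg hδ.le (sq_nonneg r)]
    have h1 := h0.neg_le_laplacian continuous_const ((ψ - w).smooth 2) hD
      fun v => by
        have := hz v
        simp only [_root_.sub_apply, Pi.sub_apply] at this ⊢
        linarith
    rw [show ⇑(ψ - w) = ⇑ψ - ⇑w from rfl,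
      (ψ.smooth 2).contDiffAt.laplacian_sub (w.smooth 2).contDiffAt] at h1
    have h2 := hw z
    have h3 := abs_le.1 (hφ z)
    have h4 := hz y
    have h5 := abs_le.1 (hK z)
    have h6 := abs_le.1 (hψ z)
    simp only [Pi.sub_apply] at h4
    nlinarith
  have hmean := le_setAverage_ball_of_le_laplacian μ (w.smooth 2) hC (x := x) (K := -c - 2 * η / t)
    hR fun y _ => by
      have h1 := hlow y
      have h2 := hw y
      have h3 := abs_le.1 (hφ y)
      have h4 : t * (2 * η / t) = 2 * η := by field_simp
      refine le_of_mul_le_mul_left (a := t) ?_ ht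
      nlinarith
  have havg : ⨍ y in ball x R, w y ∂μ
      ≤ ⨍ y in ball x R, b y ∂μ + (ε / 16 + ε / 16 + η + t * K) := by
    have hv := measureReal_ball_pos μ x hR
    have hI (g : V → ℝ) (hg : Continuous g) : IntegrableOn g (ball x R) μ :=
      (hg.continuousOn.integrableOn_compact (isCompact_closedBall x R)).mono_set
        ball_subset_closedBall
    rw [setAverage_eq, setAverage_eq, smul_eq_mul, smul_eq_mul, inv_mul_le_iff₀ hv, mul_add,
      mul_inv_cancel_left₀ hv.ne']
    have : ∫ y in ball x R, w y ∂μ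
        ≤ ∫ y in ball x R, (b y + (ε / 16 + ε / 16 + η + t * K)) ∂μ :=
      setIntegral_mono (hI _ w.continuous) (hI _ (hb.add continuous_const)) fun y => by
        have h1 := hup y
        have h2 := abs_le.1 (hψ y)
        dsimp only; linarith
    rwa [integral_add (hI _ hb) (hI _ continuous_const), setIntegral_const, smul_eq_mul] at this
  have h1 := hlow x
  have h2 : (-c - 2 * η / t) * θ / 2 * R ^ 2
    = -(c * θ / 2 * R ^ 2) - 2 * η / t * θ / 2 * R ^ 2 := by ring
  rw [h2] at hmean
  have h3 : t * (K + c) = t * K + t * c := by ring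
  linarith

/-- The sub-mean value inequality, with an error term, for nonnegative bounded upper semicontinuous
compactly supported functions whose upper Laplace parameter is bounded below. -/
lemma UpperSemicontinuous.le_setAverage_ball_add {b : V → ℝ} {M : ℝ}
    (hb : UpperSemicontinuous b) (h0 : ∀ x, 0 ≤ b x) (hM : ∀ x, b x ≤ M)
    (hcs : HasCompactSupport b) {c : ℝ} (hc : 0 ≤ c)
    (hL : ∀ x, UpperLaplaceGE μ b (c * paraboloidMean μ / 2) x) (x : V) {R : ℝ} (hR : 0 < R) :
    b x ≤ ⨍ y in ball x R, b y ∂μ + c * paraboloidMean μ / 2 * R ^ 2 := by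
  have hM0 : 0 ≤ M := (h0 x).trans (hM x)
  have hfin (x : V) (r : ℝ) : IsFiniteMeasure (μ.restrict (ball x r)) :=
    ⟨by simpa using measure_ball_lt_top⟩
  have hI (f : V → ℝ) (hf : Measurable f) (h0 : ∀ x, 0 ≤ f x) (hM : ∀ x, f x ≤ M) (x : V) (r : ℝ) :
      IntegrableOn f (ball x r) μ :=
    have := hfin x r
    Integrable.of_bound hf.aestronglyMeasurable M
      (Eventually.of_forall fun y => by rw [Real.norm_of_nonneg (h0 y)]; exact hM y)
  have hLn (n : ℕ) (z : V) :
      UpperLaplaceGE μ (supConv b (n + 1)) (c * paraboloidMean μ / 2) z := by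
    intro ε hε
    have hn : (0 : ℝ) ≤ n + 1 := by positivity
    obtain ⟨y, hy, heq⟩ := exists_supConv_eq hb h0 hM
      (show (1 : ℝ) ≤ n + 1 by linarith [n.cast_nonneg (α := ℝ)]) z
    refine ((hL y ε hε).and_eventually self_mem_nhdsWithin).mono fun r ⟨hr, hr0⟩ => ?_
    have hr0 : 0 < r := hr0
    have hv := measureReal_ball_pos μ (0 : V) one_pos
    have : IsFiniteMeasure (μ.restrict (ball (0 : V) 1)) := hfin _ _
    have hInt : IntegrableOn (fun v => b (y + r • v)) (ball (0 : V) 1) μ :=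
      hI _ (hb.measurable.comp (by fun_prop)) (fun _ => h0 _) (fun _ => hM _) _ _
    have hle : ∫ v in ball (0 : V) 1, (b (y + r • v) - (n + 1) * dist z y) ∂μ
        ≤ ∫ v in ball (0 : V) 1, supConv b (n + 1) (z + r • v) ∂μ := by
      refine setIntegral_mono (hInt.sub (integrable_const _))
        (hI _ ((continuous_supConv hM hn).measurable.comp (by fun_prop))
        (fun _ => (h0 _).trans (le_supConv hM hn _)) (fun _ => supConv_le hM hn _) _ _) fun v => ?_
      simpa using le_supConv' hM hn (z + r • v) (y + r • v)
    rw [integral_sub hInt (integrable_const _), setIntegral_const, smul_eq_mul] at hle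
    rw [setAverage_ball_eq μ _ _ hr0, setAverage_eq, smul_eq_mul] at hr ⊢
    have := mul_le_mul_of_nonneg_left hle (inv_nonneg.2 hv.le)
    rw [mul_sub, inv_mul_cancel_left₀ hv.ne'] at this
    linarith
  have hstep (n : ℕ) := (continuous_supConv hM (show (0 : ℝ) ≤ n + 1 by positivity)
    ).le_setAverage_ball_add μ (hasCompactSupport_supConv hb h0 hM
    (show (1 : ℝ) ≤ n + 1 by linarith [n.cast_nonneg (α := ℝ)]) hcs) hc (hLn n) x hR
  refine le_of_tendsto_of_tendsto' (tendsto_supConv hb h0 hM x) (Tendsto.add_const _ ?_) hstep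
  have : IsFiniteMeasure (μ.restrict (ball x R)) := hfin _ _
  simp_rw [setAverage_eq]
  refine Tendsto.const_smul (tendsto_integral_of_dominated_convergence (fun _ => M)
    (fun n => (continuous_supConv hM (by positivity)).aestronglyMeasurable)
    (integrable_const _) (fun n => Eventually.of_forall fun y => ?_)
    (Eventually.of_forall fun y => tendsto_supConv hb h0 hM y)) _
  rw [Real.norm_of_nonneg ((h0 y).trans (le_supConv hM (by positivity) y))]
  exact supConv_le hM (by positivity) y

lemma setAverage_norm_sub_sq (x x₀ : V) {r : ℝ} (hr : 0 < r) :
    ⨍ y in ball x r, ‖y - x₀‖ ^ 2 ∂μ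
      = ‖x - x₀‖ ^ 2 + (⨍ y in ball (0 : V) 1, ‖y‖ ^ 2 ∂μ) * r ^ 2 := by
  have hv := measureReal_ball_pos μ (0 : V) one_pos
  have hI (g : V → ℝ) (hg : Continuous g) : IntegrableOn g (ball 0 1) μ :=
    (hg.continuousOn.integrableOn_compact (isCompact_closedBall 0 1)).mono_set
      ball_subset_closedBall
  have hodd : ∫ y in ball (0 : V) 1, ⟪x - x₀, y⟫_ℝ ∂μ = 0 := by
    have h1 : ∫ y, (ball (0 : V) 1).indicator (fun y => ⟪x - x₀, y⟫_ℝ) (-y) ∂μ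
        = -∫ y, (ball (0 : V) 1).indicator (fun y => ⟪x - x₀, y⟫_ℝ) y ∂μ := by
      rw [← integral_neg]
      refine integral_congr_ae (Eventually.of_forall fun y => ?_)
      by_cases hy : ‖y‖ < 1 <;> simp [hy]
    rw [integral_neg_eq_self, integral_indicator measurableSet_ball] at h1
    linarith
  have hexp (y : V) : ‖x + r • y - x₀‖ ^ 2
      = ‖x - x₀‖ ^ 2 + (2 * r * ⟪x - x₀, y⟫_ℝ + r ^ 2 * ‖y‖ ^ 2) := by
    rw [show x + r • y - x₀ = (x - x₀) + r • y by abel, norm_add_sq_real, inner_smul_right,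
      norm_smul, mul_pow, Real.norm_eq_abs, sq_abs]
    ring
  rw [setAverage_ball_eq μ _ _ hr, setAverage_eq, setAverage_eq]
  simp_rw [hexp]
  rw [integral_add (hI _ (by fun_prop)) (hI _ (by fun_prop)),
    integral_add (hI _ (by fun_prop)) (hI _ (by fun_prop)), integral_const_mul, integral_const_mul,
    hodd, setIntegral_const, smul_eq_mul, smul_eq_mul, smul_eq_mul]
  field_simp
  ring

/-- A bounded upper semicontinuous function whose upper Laplace parameter is nonnegative near `x₀`
satisfies the sub-mean value inequality at `x₀`. -/
lemma UpperSemicontinuous.le_setAverage_ball {f : V → ℝ} {M : ℝ} (hf : UpperSemicontinuous f)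
    (hM : ∀ y, |f y| ≤ M) {x₀ : V} {R : ℝ} (hL : ∀ y ∈ ball x₀ (3 * R), UpperLaplaceGE μ f 0 y)
    {r : ℝ} (hr : 0 < r) (hrR : r ≤ R) : f x₀ ≤ ⨍ y in ball x₀ r, f y ∂μ := by
  have hM0 : 0 ≤ M := (abs_nonneg _).trans (hM x₀)
  have hR : 0 < R := hr.trans_le hrR
  have hθ := paraboloidMean_pos μ
  obtain ⟨A, hA, hAR⟩ : ∃ A : ℝ, 0 ≤ A ∧ A * R ^ 2 = M + 1 :=
    ⟨(M + 1) / R ^ 2, by positivity, by field_simp⟩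
  set q : V → ℝ := fun y => A * (‖y - x₀‖ ^ 2 - 4 * R ^ 2) with hq
  set κ := ⨍ y in ball (0 : V) 1, ‖y‖ ^ 2 ∂μ with hκ
  have hκ0 : 0 ≤ κ := by
    rw [hκ, setAverage_eq, smul_eq_mul]
    exact mul_nonneg (by positivity) (integral_nonneg fun y => by positivity)
  set c := 2 * (A * κ) / paraboloidMean μ
  have hc : c * paraboloidMean μ / 2 = A * κ := by simp only [c]; field_simp
  have hqc : Continuous q := by fun_prop
  have hI (g : V → ℝ) (hg : Continuous g) (x : V) (r : ℝ) : IntegrableOn g (ball x r) μ :=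
    (hg.continuousOn.integrableOn_compact (isCompact_closedBall x r)).mono_set
      ball_subset_closedBall
  have hqI (x : V) (r : ℝ) : IntegrableOn q (ball x r) μ := hI q hqc x r
  have hfI (x : V) (r : ℝ) : IntegrableOn f (ball x r) μ :=
    Measure.integrableOn_of_bounded measure_ball_lt_top.ne hf.measurable.aestronglyMeasurable
      (Eventually.of_forall hM)
  have hsub (g : V → ℝ) (x : V) (r : ℝ) (hg : IntegrableOn g (ball x r) μ) :
      ⨍ y in ball x r, (g y - q y) ∂μ = ⨍ y in ball x r, g y ∂μ - ⨍ y in ball x r, q y ∂μ := by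
    simp only [setAverage_eq, smul_eq_mul]
    rw [integral_sub hg (hqI x r), mul_sub]
  have hqavg (x : V) (r : ℝ) (hr : 0 < r) : ⨍ y in ball x r, q y ∂μ = q x + A * κ * r ^ 2 := by
    have h1 := setAverage_norm_sub_sq μ x x₀ hr
    have hv := measureReal_ball_pos μ x hr
    rw [setAverage_eq, smul_eq_mul] at h1 ⊢
    rw [hq, integral_const_mul, integral_sub (hI _ (by fun_prop) x r) (hI _ (by fun_prop) x r),
      setIntegral_const, smul_eq_mul, mul_left_comm, mul_sub, h1, inv_mul_cancel_left₀ hv.ne']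
    ring
  set b : V → ℝ := fun y => max (f y - q y) 0 with hb
  have hbusc : UpperSemicontinuous b := by
    have h1 : UpperSemicontinuous fun y => f y - q y := by
      simpa [sub_eq_add_neg] using hf.add hqc.neg.upperSemicontinuous
    exact h1.sup continuous_const.upperSemicontinuous
  have hb0 (y : V) : 0 ≤ b y := le_max_right _ _
  have hbM (y : V) : b y ≤ M + 4 * (M + 1) := by
    refine max_le ?_ (by positivity)
    have := (abs_le.1 (hM y)).2
    have h2 : 0 ≤ A * ‖y - x₀‖ ^ 2 := by positivity
    simp only [hq]
    linarith
  have hbout (y : V) (hy : y ∉ ball x₀ (3 * R)) : b y = 0 := by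
    rw [mem_ball, dist_eq_norm, not_lt] at hy
    refine max_eq_right ?_
    have := (abs_le.1 (hM y)).2
    have h2 : A * (3 * R) ^ 2 ≤ A * ‖y - x₀‖ ^ 2 := by gcongr
    simp only [hq]
    linarith
  have hbin (y : V) (hy : y ∈ closedBall x₀ R) : b y = f y - q y := by
    rw [mem_closedBall, dist_eq_norm] at hy
    refine max_eq_left ?_
    have := (abs_le.1 (hM y)).1
    have h2 : A * ‖y - x₀‖ ^ 2 ≤ A * R ^ 2 := by gcongr
    simp only [hq]
    linarith
  have hcs : HasCompactSupport b := HasCompactSupport.intro (isCompact_closedBall x₀ (3 * R))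
    fun y hy => hbout y fun h => hy (ball_subset_closedBall h)
  have hbI (x : V) (r : ℝ) : IntegrableOn b (ball x r) μ :=
    Measure.integrableOn_of_bounded measure_ball_lt_top.ne hbusc.measurable.aestronglyMeasurable
      (Eventually.of_forall fun y => by rw [Real.norm_of_nonneg (hb0 y)]; exact hbM y)
  have hbL (y : V) : UpperLaplaceGE μ b (c * paraboloidMean μ / 2) y := by
    rw [hc]
    intro ε hε
    rcases (hb0 y).eq_or_lt with h | h
    · refine (Eventually.of_forall fun r => ?_).frequently
      rw [← h, setAverage_eq, smul_eq_mul]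
      have h1 : 0 ≤ (μ.real (ball y r))⁻¹ * ∫ z in ball y r, b z ∂μ :=
        mul_nonneg (by positivity) (integral_nonneg hb0)
      have h2 : 0 ≤ (A * κ + ε) * r ^ 2 := by positivity
      linarith
    · have hy : y ∈ ball x₀ (3 * R) := by
        by_contra hy
        exact h.ne' (hbout y hy)
      have hby : b y = f y - q y := max_eq_left (le_of_lt (by simpa [hb] using h))
      refine ((hL y hy ε hε).and_eventually self_mem_nhdsWithin).mono fun s ⟨hs, hs0⟩ => ?_
      have h1 : ⨍ z in ball y s, (f z - q z) ∂μ ≤ ⨍ z in ball y s, b z ∂μ := by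
        simp only [setAverage_eq, smul_eq_mul]
        exact mul_le_mul_of_nonneg_left (setIntegral_mono ((hfI y s).sub (hqI y s)) (hbI y s)
          fun z => le_max_left (f z - q z) 0) (by positivity)
      rw [hsub f y s (hfI y s), hqavg y s hs0] at h1
      rw [hby]
      linarith
  have hmain := hbusc.le_setAverage_ball_add μ hb0 hbM hcs (by positivity) hbL x₀ hr
  have havg : ⨍ y in ball x₀ r, b y ∂μ = ⨍ y in ball x₀ r, (f y - q y) ∂μ := by
    rw [setAverage_eq, setAverage_eq, setIntegral_congr_fun measurableSet_ball]
    exact fun y hy => hbin y (ball_subset_closedBall (ball_subset_ball hrR hy))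
  rw [havg, hsub f x₀ r (hfI x₀ r), hqavg x₀ r hr, hc, hbin x₀ (mem_closedBall_self hR.le)] at hmain
  linarith
end BallMeans

section Truncation

variable {V : Type*}

open Classical in
/-- The truncation of `u` from below at `-N`, extended by `-N` outside `s`. -/
def truncBelow (u : V → EReal) (s : Set V) (N : ℕ) (y : V) : ℝ :=
  if y ∈ s then (max (u y) (-(N : ℝ) : ℝ)).toReal else -N

variable {u : V → EReal} {s : Set V}

lemma coe_truncBelow (hu : ∀ y ∈ s, u y < ⊤) (N : ℕ) {y : V} (hy : y ∈ s) :
    (truncBelow u s N y : EReal) = max (u y) (-(N : ℝ) : ℝ) := by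
  rw [truncBelow, if_pos hy, EReal.coe_toReal]
  · exact (max_lt (hu y hy) (EReal.coe_lt_top _)).ne
  · exact ((EReal.bot_lt_coe _).trans_le (le_max_right _ _)).ne'

lemma neg_le_truncBelow (hu : ∀ y ∈ s, u y < ⊤) (N : ℕ) (y : V) :
    -(N : ℝ) ≤ truncBelow u s N y := by
  by_cases hy : y ∈ s
  · rw [← EReal.coe_le_coe_iff, coe_truncBelow hu N hy]
    exact le_max_right _ _
  · rw [truncBelow, if_neg hy]

lemma abs_truncBelow_le {M : ℝ} (hM : ∀ y ∈ s, u y ≤ M) (N : ℕ) (y : V) :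
    |truncBelow u s N y| ≤ max (N : ℝ) M := by
  have hu (y : V) (hy : y ∈ s) : u y < ⊤ := (hM y hy).trans_lt (EReal.coe_lt_top _)
  have hN : -(N : ℝ) ≤ max (N : ℝ) M := by
    linarith [N.cast_nonneg (α := ℝ), le_max_left (N : ℝ) M]
  refine abs_le.2 ⟨(neg_le_neg (le_max_left _ _)).trans (neg_le_truncBelow hu N y), ?_⟩
  by_cases hy : y ∈ s
  · rw [← EReal.coe_le_coe_iff, coe_truncBelow hu N hy]
    exact max_le ((hM y hy).trans (EReal.coe_le_coe_iff.2 (le_max_right _ _)))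
      (EReal.coe_le_coe_iff.2 hN)
  · rwa [truncBelow, if_neg hy]

lemma erealToENNReal_mono : Monotone erealToENNReal := fun _ _ h => EReal.toENNReal_le_toENNReal h

lemma erealToENNReal_coe (x : ℝ) : erealToENNReal x = ENNReal.ofReal x :=
  EReal.real_coe_toENNReal x

lemma ofReal_truncBelow (hu : ∀ y ∈ s, u y < ⊤) (N : ℕ) {y : V} (hy : y ∈ s) :
    ENNReal.ofReal (truncBelow u s N y) = erealToENNReal (u y) := by
  rw [← erealToENNReal_coe, coe_truncBelow hu N hy, erealToENNReal_mono.map_max,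
    erealToENNReal_coe, ENNReal.ofReal_of_nonpos (by simp)]
  exact max_eq_left zero_le

lemma ofReal_neg_truncBelow (hu : ∀ y ∈ s, u y < ⊤) (N : ℕ) {y : V} (hy : y ∈ s) :
    ENNReal.ofReal (-truncBelow u s N y) = min (erealToENNReal (-u y)) N := by
  rw [← erealToENNReal_coe, EReal.coe_neg, coe_truncBelow hu N hy,
    EReal.neg_strictAnti.antitone.map_max, erealToENNReal_mono.map_min, EReal.coe_neg, neg_neg,
    erealToENNReal_coe, ENNReal.ofReal_natCast]

variable [NormedAddCommGroup V]

lemma upperSemicontinuous_truncBelow (hs : IsClosed s) (hu : ∀ y ∈ s, u y < ⊤)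
    (husc : UpperSemicontinuousOn u s) (N : ℕ) : UpperSemicontinuous (truncBelow u s N) := by
  intro x a ha
  have hN : -(N : ℝ) < a := (neg_le_truncBelow hu N x).trans_lt ha
  have hout (y : V) (hy : y ∉ s) : truncBelow u s N y < a := by rwa [truncBelow, if_neg hy]
  by_cases hx : x ∈ s
  · rw [← EReal.coe_lt_coe_iff, coe_truncBelow hu N hx, max_lt_iff] at ha
    filter_upwards [eventually_nhdsWithin_iff.1 (husc x hx a ha.1)] with y hy
    by_cases hys : y ∈ s
    · rw [← EReal.coe_lt_coe_iff, coe_truncBelow hu N hys]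
      exact max_lt (hy hys) ha.2
    · exact hout y hys
  · filter_upwards [hs.isOpen_compl.mem_nhds hx] with y hy using hout y hy

variable [MeasureSpace V]

lemma coe_setAverage_eq_erealBallAvg {f : V → ℝ} {x : V} {r : ℝ}
    (hf : IntegrableOn f (ball x r)) (hv : volume (ball x r) ≠ 0) :
    ((⨍ y in ball x r, f y : ℝ) : EReal) = erealBallAvg (fun y => f y) x r := by
  have hfin (g : V → ℝ) (hg : IntegrableOn g (ball x r)) :
      (∫⁻ y in ball x r, ENNReal.ofReal (g y)) / volume (ball x r) ≠ ⊤ :=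
    ENNReal.div_ne_top hg.lintegral_lt_top.ne hv
  simp only [erealBallAvg, ← EReal.coe_neg, erealToENNReal_coe]
  rw [← EReal.coe_ennreal_toReal (hfin f hf),
    ← EReal.coe_ennreal_toReal (hfin (fun y => -f y) hf.neg),
    ← EReal.coe_sub, setAverage_eq, integral_eq_lintegral_pos_part_sub_lintegral_neg_part hf,
    ENNReal.toReal_div, ENNReal.toReal_div, smul_eq_mul]
  congr 1
  simp only [Measure.real]
  ring

lemma erealBallAvg_truncBelow (hu : ∀ y ∈ s, u y < ⊤) (N : ℕ) {x : V} {r : ℝ}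
    [OpensMeasurableSpace V] (hs : ball x r ⊆ s) :
    erealBallAvg (fun y => truncBelow u s N y) x r
      = (((∫⁻ y in ball x r, erealToENNReal (u y)) / volume (ball x r) : ℝ≥0∞) : EReal)
        - (((∫⁻ y in ball x r, min (erealToENNReal (-u y)) N) / volume (ball x r) : ℝ≥0∞) :
          EReal) := by
  simp only [erealBallAvg, ← EReal.coe_neg, erealToENNReal_coe]
  rw [setLIntegral_congr_fun measurableSet_ball fun y hy => ofReal_truncBelow hu N (hs hy),
    setLIntegral_congr_fun measurableSet_ball fun y hy => ofReal_neg_truncBelow hu N (hs hy)]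

lemma erealBallAvg_le_erealBallAvg_truncBelow (hu : ∀ y ∈ s, u y < ⊤) (N : ℕ) {x : V} {r : ℝ}
    [OpensMeasurableSpace V] (hs : ball x r ⊆ s) :
    erealBallAvg u x r ≤ erealBallAvg (fun y => truncBelow u s N y) x r := by
  rw [erealBallAvg_truncBelow hu N hs]
  refine EReal.sub_le_sub le_rfl ?_
  rw [EReal.coe_ennreal_le_coe_ennreal_iff]
  gcongr
  exact min_le_left _ _

lemma tendsto_erealBallAvg_truncBelow [BorelSpace V] (hs : IsClosed s) {M : ℝ}
    (hM : ∀ y ∈ s, u y ≤ M) (husc : UpperSemicontinuousOn u s) {x : V} {r : ℝ}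
    (hxs : ball x r ⊆ s) (hv : volume (ball x r) ≠ 0) (hv' : volume (ball x r) ≠ ⊤) :
    Tendsto (fun N => erealBallAvg (fun y => truncBelow u s N y) x r) atTop
      (𝓝 (erealBallAvg u x r)) := by
  have hu (y : V) (hy : y ∈ s) : u y < ⊤ := (hM y hy).trans_lt (EReal.coe_lt_top _)
  have hsup : ∫⁻ y in ball x r, erealToENNReal (-u y)
      = ⨆ N : ℕ, ∫⁻ y in ball x r, ENNReal.ofReal (-truncBelow u s N y) := by
    rw [← lintegral_iSup']
    · refine setLIntegral_congr_fun measurableSet_ball fun y hy => ?_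
      simp only [ofReal_neg_truncBelow hu _ (hxs hy)]
      rw [← inf_iSup_eq, ENNReal.iSup_natCast, inf_top_eq]
    · exact fun N => ((upperSemicontinuous_truncBelow hs hu husc N).measurable.neg.ennreal_ofReal
        ).aemeasurable
    · filter_upwards [ae_restrict_mem measurableSet_ball] with y hy
      intro N N' h
      simp only [ofReal_neg_truncBelow hu _ (hxs hy)]
      gcongr
  have hmono : Monotone fun N : ℕ => ∫⁻ y in ball x r, min (erealToENNReal (-u y)) N :=
    fun N N' h => lintegral_mono fun y => by dsimp only; gcongr
  have htend : Tendsto (fun N : ℕ => ∫⁻ y in ball x r, min (erealToENNReal (-u y)) N) atTop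
      (𝓝 (∫⁻ y in ball x r, erealToENNReal (-u y))) := by
    rw [hsup]
    simp only [setLIntegral_congr_fun measurableSet_ball
      fun y hy => ofReal_neg_truncBelow hu _ (hxs hy)]
    exact tendsto_atTop_iSup hmono
  have hP : (∫⁻ y in ball x r, erealToENNReal (u y)) / volume (ball x r) ≠ ⊤ := by
    refine ENNReal.div_ne_top
      (ne_top_of_le_ne_top (b := ∫⁻ y in ball x r, ENNReal.ofReal M) ?_ ?_) hv
    · simp [ENNReal.mul_eq_top, hv']
    · refine setLIntegral_mono' measurableSet_ball fun y hy => ?_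
      rw [← erealToENNReal_coe]
      exact erealToENNReal_mono (hM y (hxs hy))
  simp only [erealBallAvg_truncBelow hu _ hxs]
  simp only [erealBallAvg, sub_eq_add_neg]
  refine (EReal.continuousAt_add (Or.inl ?_) (Or.inl ?_)).tendsto.comp
    (tendsto_const_nhds.prodMk_nhds ((continuous_neg.tendsto _).comp
    ((continuous_coe_ennreal_ereal.tendsto _).comp (ENNReal.Tendsto.div_const htend (Or.inr hv)))))
  · exact EReal.coe_ennreal_eq_top_iff.not.2 hP
  · exact EReal.coe_ennreal_ne_bot _

end Truncation

lemma IsSubharmonicOn.upperLaplace_nonneg {m : ℕ} {u : E → EReal} {s : Set E}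
    (hu : IsSubharmonicOn u s) (hs : IsOpen s) {x : E} (hx : x ∈ s) (hbot : u x ≠ ⊥) :
    0 ≤ upperLaplace m u x := by
  obtain ⟨R, hR, hsub⟩ := hu.2.2.2 x hx
  obtain ⟨ρ, hρ, hball⟩ := Metric.nhds_basis_closedBall.mem_iff.1 (hs.mem_nhds hx)
  refine mul_nonneg (EReal.coe_nonneg.2 (by positivity)) (le_limsup_of_frequently_le'
    (Eventually.frequently ?_))
  filter_upwards [Ioo_mem_nhdsGT (lt_min hR hρ)] with r ⟨hr, hrR⟩
  refine mul_nonneg (EReal.coe_nonneg.2 (by positivity)) ?_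
  rw [EReal.sub_nonneg (Or.inr (hu.2.2.1 x hx).ne) (Or.inr hbot)]
  exact hsub r hr (hrR.trans_le (min_le_left _ _))
    ((closedBall_subset_closedBall (hrR.le.trans (min_le_right _ _))).trans hball)

section Converse

variable {V : Type*} [NormedAddCommGroup V] [InnerProductSpace ℝ V] [FiniteDimensional ℝ V]
  [MeasureSpace V] [BorelSpace V] [(volume : Measure V).IsAddHaarMeasure]
  {u : V → EReal} {s : Set V} {m : ℕ} {x : V}

lemma upperLaplaceGE_truncBelow {M : ℝ} (hs : IsClosed s)
    (hM : ∀ y ∈ s, u y ≤ M) (husc : UpperSemicontinuousOn u s) (N : ℕ) (hx : s ∈ 𝓝 x)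
    (hL : u x ≠ ⊥ → 0 ≤ upperLaplace m u x) :
    UpperLaplaceGE volume (truncBelow u s N) 0 x := by
  have hu (y : V) (hy : y ∈ s) : u y < ⊤ := (hM y hy).trans_lt (EReal.coe_lt_top _)
  have hxs : x ∈ s := mem_of_mem_nhds hx
  have hInt (r : ℝ) : IntegrableOn (truncBelow u s N) (ball x r) :=
    Measure.integrableOn_of_bounded measure_ball_lt_top.ne
      (upperSemicontinuous_truncBelow hs hu husc N).measurable.aestronglyMeasurable
      (Eventually.of_forall (abs_truncBelow_le hM N))
  intro ε hε
  rw [zero_add]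
  obtain ⟨ρ, hρ, hball⟩ := Metric.mem_nhds_iff.1 hx
  have hcoe := coe_truncBelow hu N hxs
  rcases lt_or_ge (u x) (-(N : ℝ) : ℝ) with hlt | hge
  · rw [max_eq_right hlt.le, EReal.coe_eq_coe_iff] at hcoe
    refine Eventually.frequently ?_
    filter_upwards [self_mem_nhdsWithin] with r hr
    have hv := measureReal_ball_pos volume x hr
    have h1 : ∫ y in ball x r, -(N : ℝ) ≤ ∫ y in ball x r, truncBelow u s N y :=
      setIntegral_mono (integrableOn_const measure_ball_lt_top.ne) (hInt r)
        fun y => neg_le_truncBelow hu N y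
    rw [setIntegral_const, smul_eq_mul] at h1
    have h2 := (le_inv_mul_iff₀ hv).2 h1
    rw [hcoe, setAverage_eq, smul_eq_mul]
    nlinarith [mul_pos hε (pow_pos hr 2)]
  · rw [max_eq_left hge] at hcoe
    have hbot : u x ≠ ⊥ := ((EReal.bot_lt_coe _).trans_le hge).ne'
    have hlim : 0 ≤ limsup (fun r : ℝ => (((r ^ 2)⁻¹ : ℝ) : EReal) * (erealBallAvg u x r - u x))
        (𝓝[>] (0 : ℝ)) := by
      have hpos : (0 : EReal) < ((2 * ((m : ℝ) + 2) : ℝ) : EReal) :=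
        EReal.coe_pos.2 (by positivity)
      rcases EReal.mul_nonneg_iff.1 (hL hbot) with h | h
      · exact h.2
      · exact absurd h.1 hpos.not_ge
    have hneg : ((-ε : ℝ) : EReal) < 0 := by exact_mod_cast neg_neg_of_pos hε
    refine ((frequently_lt_of_lt_limsup (h := hneg.trans_le hlim)).and_eventually
      (Ioo_mem_nhdsGT hρ)).mono fun r ⟨hr, hr0, hrρ⟩ => ?_
    have hle := erealBallAvg_le_erealBallAvg_truncBelow hu N
      ((ball_subset_ball hrρ.le).trans hball)
    rw [← coe_setAverage_eq_erealBallAvg (hInt r) (measure_ball_pos volume x hr0).ne'] at hle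
    rw [← hcoe] at hr
    induction h : erealBallAvg u x r with
    | bot =>
      rw [h, EReal.bot_sub, EReal.coe_mul_bot_of_pos (by positivity)] at hr
      exact absurd hr not_lt_bot
    | top =>
      rw [h] at hle
      exact absurd hle (EReal.coe_lt_top _).not_ge
    | coe a =>
      rw [h, ← EReal.coe_sub, ← EReal.coe_mul, EReal.coe_lt_coe_iff, lt_inv_mul_iff₀
        (by positivity)] at hr
      rw [h, EReal.coe_le_coe_iff] at hle
      linarith

lemma submeanOn_of_upperLaplace_nonneg (hs : IsOpen s) (husc : UpperSemicontinuousOn u s)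
    (hnt : ∀ x ∈ s, u x < ⊤) (hL : ∀ x ∈ s, u x ≠ ⊥ → 0 ≤ upperLaplace m u x) :
    SubmeanOn u s := by
  intro x hx
  obtain ⟨ρ, hρ, hball⟩ := Metric.nhds_basis_closedBall.mem_iff.1 (hs.mem_nhds hx)
  obtain ⟨R, hR, rfl⟩ : ∃ R > 0, ρ = 3 * R := ⟨ρ / 3, by positivity, by ring⟩
  set B := closedBall x (3 * R)
  have huscB : UpperSemicontinuousOn u B := husc.mono hball
  obtain ⟨z, hz, hmax⟩ := huscB.exists_isMaxOn ⟨x, mem_closedBall_self hρ.le⟩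
    (isCompact_closedBall x (3 * R))
  obtain ⟨M, hM⟩ : ∃ M : ℝ, ∀ y ∈ B, u y ≤ M :=
    ⟨(u z).toReal, fun y hy => (hmax hy).trans (EReal.le_coe_toReal (hnt z (hball hz)).ne)⟩
  have hu (y : V) (hy : y ∈ B) : u y < ⊤ := hnt y (hball hy)
  refine ⟨R, hR, fun r hr hrR _ => ?_⟩
  have hrB : ball x r ⊆ B := ball_subset_closedBall.trans
    (closedBall_subset_closedBall (by linarith))
  have hv := (measure_ball_pos volume x hr).ne'
  refine ge_of_tendsto' (tendsto_erealBallAvg_truncBelow isClosed_closedBall hM huscB hrB hv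
    measure_ball_lt_top.ne) fun N => ?_
  have hbd := abs_truncBelow_le hM N
  have hfusc := upperSemicontinuous_truncBelow isClosed_closedBall hu huscB N
  rw [← coe_setAverage_eq_erealBallAvg (Measure.integrableOn_of_bounded measure_ball_lt_top.ne
    hfusc.measurable.aestronglyMeasurable (Eventually.of_forall hbd)) hv]
  calc u x ≤ (truncBelow u B N x : EReal) := by
        rw [coe_truncBelow hu N (mem_closedBall_self hρ.le)]
        exact le_max_left _ _
    _ ≤ _ := EReal.coe_le_coe_iff.2 (hfusc.le_setAverage_ball volume hbd (fun y hy =>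
        upperLaplaceGE_truncBelow isClosed_closedBall hM huscB N
          (mem_of_superset (isOpen_ball.mem_nhds hy) ball_subset_closedBall)
          (hL y (hball (ball_subset_closedBall hy)))) hr hrR.le)

end Converse

/-- Theorem (statement 15, Blaschke–Privalov criterion): an upper semicontinuous function
`u : Ω → [-∞,∞)`, not identically `-∞`, is subharmonic on the domain `Ω ⊆ ℝᵐ` if and only if
`Δ̄u(x) ≥ 0` for every `x ∈ Ω` with `u(x) ≠ -∞`. -/
theorem blaschke_privalov (m : ℕ) (Ω : Set (EuclideanSpace ℝ (Fin m)))
    (hopen : IsOpen Ω) (hconn : IsConnected Ω)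
    (u : EuclideanSpace ℝ (Fin m) → EReal)
    (husc : UpperSemicontinuousOn u Ω) (hnb : ¬ ∀ x ∈ Ω, u x = ⊥)
    (hnt : ∀ x ∈ Ω, u x < ⊤) :
    IsSubharmonicOn u Ω ↔ ∀ x ∈ Ω, u x ≠ ⊥ → 0 ≤ upperLaplace m u x :=
  ⟨fun h _ hx hbot => h.upperLaplace_nonneg hopen hx hbot,
    fun h => ⟨husc, hnb, hnt, submeanOn_of_upperLaplace_nonneg hopen husc hnt h⟩⟩

end
end

section
/- (Crasta–Malusa) Let Ω ⊂ ℝ^m be a bounded domain with C²-smooth boundary. Then the cut locus Σ of Ω has Lebesgue measure zero. -/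
open MeasureTheory Metric Filter Topology Set
open scoped ENNReal

noncomputable section

/-- The medial axis of `Ω`: points of `Ω` with more than one nearest boundary point. -/
def medialAxis {X : Type*} [MetricSpace X] (Ω : Set X) : Set X :=
  {x ∈ Ω | ∃ y ∈ frontier Ω, ∃ z ∈ frontier Ω, y ≠ z ∧
    dist x y = infDist x (frontier Ω) ∧ dist x z = infDist x (frontier Ω)}

/-- The cut locus of `Ω`: the closure of the medial axis in `Ω`. -/
def cutLocus {X : Type*} [MetricSpace X] (Ω : Set X) : Set X :=
  closure (medialAxis Ω) ∩ Ω

/-- `ρ` is a `C^k` local defining function for the domain `Ω` near the boundary point `p`,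
defined on the open neighborhood `V`: it is `C^k` on `V`, has nonvanishing gradient on the
boundary, is negative exactly on `Ω ∩ V` and vanishes exactly on `∂Ω ∩ V`. -/
def IsLocalDefiningFunction {F : Type*} [NormedAddCommGroup F] [NormedSpace ℝ F]
    (Ω : Set F) (k : ℕ∞) (p : F) (V : Set F) (ρ : F → ℝ) : Prop :=
  IsOpen V ∧ p ∈ V ∧ ContDiffOn ℝ k ρ V ∧
    (∀ q ∈ V ∩ frontier Ω, fderiv ℝ ρ q ≠ 0) ∧
    Ω ∩ V = {q | q ∈ V ∧ ρ q < 0} ∧ frontier Ω ∩ V = {q | q ∈ V ∧ ρ q = 0}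

/-- `Ω` has `C^k`-smooth boundary: every boundary point admits a `C^k` local defining
function. -/
def HasCkBoundary {F : Type*} [NormedAddCommGroup F] [NormedSpace ℝ F]
    (Ω : Set F) (k : ℕ∞) : Prop :=
  ∀ p ∈ frontier Ω, ∃ V ρ, IsLocalDefiningFunction Ω k p V ρ

section NearestPoints

/-- Where the distance to `K` is differentiable, the nearest point of `K` is unique. -/
lemma eq_of_dist_eq_infDist_of_differentiableAt {E : Type*} [NormedAddCommGroup E]
    [NormedSpace ℝ E] [StrictConvexSpace ℝ E] {K : Set E} {x y z : E}
    (hd : DifferentiableAt ℝ (infDist · K) x) (hy : y ∈ K) (hz : z ∈ K)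
    (hxy : dist x y = infDist x K) (hxz : dist x z = infDist x K) : y = z := by
  set D := fderiv ℝ (infDist · K) x with hD
  have key : ∀ u ∈ K, dist x u = infDist x K → D (u - x) ≤ -infDist x K := by
    intro u hu hxu
    have hline : HasDerivAt (fun t : ℝ => x + t • (u - x)) (u - x) 0 := by
      simpa using ((hasDerivAt_id (0 : ℝ)).smul_const (u - x)).const_add x
    have hcomp : HasDerivAt (fun t : ℝ => infDist (x + t • (u - x)) K) (D (u - x)) 0 := by
      have h : HasFDerivAt (infDist · K) D (x + (0 : ℝ) • (u - x)) := by
        simpa using hd.hasFDerivAt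
      exact h.comp_hasDerivAt (0 : ℝ) hline
    refine le_of_tendsto hcomp.tendsto_slope_zero_right ?_
    filter_upwards [Ioo_mem_nhdsGT (zero_lt_one' ℝ)] with t ht
    have hle : infDist (x + t • (u - x)) K ≤ (1 - t) * infDist x K := by
      refine (infDist_le_dist_of_mem hu).trans_eq ?_
      rw [← hxu, dist_eq_norm, dist_eq_norm,
        show x + t • (u - x) - u = (1 - t) • (x - u) by module, norm_smul,
        Real.norm_of_nonneg (by linarith [ht.2])]
    simp only [zero_add, zero_smul, add_zero, smul_eq_mul]
    rw [inv_mul_le_iff₀ ht.1]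
    linarith
  have hD1 : ‖D‖ ≤ 1 := by
    simpa using norm_fderiv_le_of_lipschitz ℝ (x₀ := x) (lipschitz_infDist_pt K)
  have hy' : ‖y - x‖ = infDist x K := by rw [← hxy, dist_comm, dist_eq_norm]
  have hz' : ‖z - x‖ = infDist x K := by rw [← hxz, dist_comm, dist_eq_norm]
  have hle : ‖y - x‖ + ‖z - x‖ ≤ ‖(y - x) + (z - x)‖ := by
    have h1 : -D ((y - x) + (z - x)) ≤ ‖(y - x) + (z - x)‖ :=
      (neg_le_abs _).trans ((D.le_opNorm _).trans
        (mul_le_of_le_one_left (norm_nonneg _) hD1))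
    rw [map_add] at h1
    linarith [key y hy hxy, key z hz hxz]
  have := eq_of_norm_eq_of_norm_add_eq (hy'.trans hz'.symm) (le_antisymm (norm_add_le _ _) hle)
  exact sub_left_injective this

lemma volume_medialAxis {E : Type*} [NormedAddCommGroup E] [InnerProductSpace ℝ E]
    [FiniteDimensional ℝ E] [MeasurableSpace E] [BorelSpace E] (Ω : Set E) :
    volume (medialAxis Ω) = 0 := by
  have h := (lipschitz_infDist_pt (frontier Ω)).ae_differentiableAt (μ := volume)
  refine measure_mono_null ?_ h
  rintro x ⟨-, y, hy, z, hz, hne, hxy, hxz⟩ hd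
  exact hne (eq_of_dist_eq_infDist_of_differentiableAt hd hy hz hxy hxz)

/-- Nearest points of a sequence converge to the nearest point of the limit, if it is unique. -/
lemma tendsto_nearest_point {X ι : Type*} [MetricSpace X] {K : Set X} (hK : IsCompact K)
    {l : Filter ι} {u v : ι → X} {x y : X} (hu : Tendsto u l (𝓝 x)) (hv : ∀ i, v i ∈ K)
    (huv : ∀ i, dist (u i) (v i) = infDist (u i) K)
    (huniq : ∀ y' ∈ K, dist x y' = infDist x K → y' = y) : Tendsto v l (𝓝 y) := by
  refine hK.tendsto_nhds_of_unique_mapClusterPt (Eventually.of_forall hv) fun y' hy' hc => ?_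
  obtain ⟨U, hU, hlim⟩ := mapClusterPt_iff_ultrafilter.1 hc
  refine huniq y' hy' (tendsto_nhds_unique ((hu.mono_left hU).dist hlim) ?_)
  simp only [huv]
  exact ((continuous_infDist_pt K).tendsto x).comp (hu.mono_left hU)

end NearestPoints

section Calculus

/-- If a strictly differentiable map fails to be injective near a point, its differential there
is singular. -/
lemma HasStrictFDerivAt.det_eq_zero_of_tendsto {E ι : Type*} [NormedAddCommGroup E]
    [NormedSpace ℝ E] [FiniteDimensional ℝ E] {G : E → E} {G' : E →L[ℝ] E} {w : E}
    (hG : HasStrictFDerivAt G G' w) {l : Filter ι} [l.NeBot] {u v : ι → E}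
    (hu : Tendsto u l (𝓝 w)) (hv : Tendsto v l (𝓝 w))
    (h : ∀ᶠ i in l, u i ≠ v i ∧ G (u i) = G (v i)) : G'.det = 0 := by
  have := FiniteDimensional.complete ℝ E
  by_contra hdet
  have hG' : HasStrictFDerivAt G
      ((G'.toContinuousLinearEquivOfDetNeZero hdet : E ≃L[ℝ] E) : E →L[ℝ] E) w := by
    simpa using hG
  have hinv := hG'.eventually_left_inverse
  obtain ⟨i, h1, h2, hne, heq⟩ :=
    ((hu.eventually hinv).and ((hv.eventually hinv).and h)).exists
  exact hne (by rw [← h1, ← h2, heq])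

variable {E : Type*} [NormedAddCommGroup E] [InnerProductSpace ℝ E] [FiniteDimensional ℝ E]

/-- At a nearest point of a regular level set, the displacement is normal to the level set. -/
lemma sub_eq_smul_gradient_of_dist_eq_infDist {K V : Set E} {ρ : E → ℝ} (hV : IsOpen V)
    (hKV : K ∩ V = {q | q ∈ V ∧ ρ q = 0}) {x y : E} (hyV : y ∈ V) (hy : y ∈ K)
    (hρ : ContDiffAt ℝ 1 ρ y) (hne : fderiv ℝ ρ y ≠ 0) (hxy : dist x y = infDist x K) :
    x - y = (inner ℝ (gradient ρ y) (x - y) / ‖gradient ρ y‖ ^ 2) • gradient ρ y := by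
  have hzero : ∀ q ∈ V, (q ∈ K ↔ ρ q = 0) := fun q hq =>
    ⟨fun h => ((Set.ext_iff.1 hKV q).1 ⟨h, hq⟩).2, fun h => ((Set.ext_iff.1 hKV q).2 ⟨hq, h⟩).1⟩
  have hy0 : ρ y = 0 := (hzero y hyV).1 hy
  have hmin : IsLocalExtrOn (fun q => ‖q - x‖ ^ 2) {q | ρ q = ρ y} y := by
    refine Or.inl ?_
    filter_upwards [self_mem_nhdsWithin, mem_nhdsWithin_of_mem_nhds (hV.mem_nhds hyV)] with q hq hqV
    have hqK : q ∈ K := (hzero q hqV).2 (hq.trans hy0)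
    have : dist x y ≤ dist x q := hxy.trans_le (infDist_le_dist_of_mem hqK)
    rw [dist_comm x y, dist_comm x q, dist_eq_norm, dist_eq_norm] at this
    gcongr
  have hsq : HasStrictFDerivAt (fun q => ‖q - x‖ ^ 2) (2 • innerSL ℝ (y - x)) y := by
    simpa using (hasStrictFDerivAt_norm_sq (y - x)).comp y ((hasStrictFDerivAt_id y).sub_const x)
  obtain ⟨a, b, hab, hlin⟩ := hmin.exists_multipliers_of_hasStrictFDerivAt_1d
    (hρ.hasStrictFDerivAt one_ne_zero) hsq
  have hlin' : ∀ u, a * inner ℝ (gradient ρ y) u + b * (2 * inner ℝ (y - x) u) = 0 := by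
    intro u
    have := DFunLike.congr_fun hlin u
    simpa [inner_gradient_left, inner_sub_left] using this
  have hN : gradient ρ y ≠ 0 := by simpa [gradient] using hne
  have hb : b ≠ 0 := by
    rintro rfl
    have ha : a ≠ 0 := by rintro rfl; exact hab rfl
    have := hlin' (gradient ρ y)
    simp [ha, hN] at this
  have hc : x - y = (a / (2 * b)) • gradient ρ y := by
    refine ext_inner_right ℝ fun u => ?_
    have := hlin' u
    rw [← neg_sub x y, inner_neg_left] at this
    rw [real_inner_smul_left]
    field_simp
    linarith
  have hN' : ‖gradient ρ y‖ ≠ 0 := norm_ne_zero_iff.2 hN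
  have hcoef : inner ℝ (gradient ρ y) (x - y) / ‖gradient ρ y‖ ^ 2 = a / (2 * b) := by
    rw [hc, real_inner_smul_right, real_inner_self_eq_norm_sq]
    field_simp
  rw [hcoef, ← hc]

lemma ContDiffAt.gradient {ρ : E → ℝ} {q : E} (hρ : ContDiffAt ℝ 2 ρ q) :
    ContDiffAt ℝ 1 (gradient ρ) q :=
  (InnerProductSpace.toDual ℝ E).symm.contDiff.contDiffAt.comp q
    (hρ.fderiv_right (m := 1) (by norm_num))

/-- A function with nonzero derivative is locally the coordinate `⟪v, ·⟫` in suitable `C²`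
coordinates, for a unit vector `v`. -/
lemma exists_straightening {ρ : E → ℝ} {p : E} (hρ : ContDiffAt ℝ 2 ρ p)
    (hne : fderiv ℝ ρ p ≠ 0) :
    ∃ (v : E) (ψ φ : E → E), (∀ q, inner ℝ v (ψ q) = ρ q) ∧ ‖v‖ = 1 ∧
      (∀ᶠ q in 𝓝 p, φ (ψ q) = q ∧ ContDiffAt ℝ 2 φ (ψ q) ∧ ContinuousAt ψ q) := by
  have hN : gradient ρ p ≠ 0 := by simpa [gradient] using hne
  set v := ‖gradient ρ p‖⁻¹ • gradient ρ p with hv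
  have hv1 : ‖v‖ = 1 := by
    rw [hv, norm_smul, norm_inv, norm_norm, inv_mul_cancel₀ (norm_ne_zero_iff.2 hN)]
  have hvv : inner ℝ v v = 1 := by rw [real_inner_self_eq_norm_sq, hv1, one_pow]
  set ψ : E → E := fun q => q + (ρ q - inner ℝ v q) • v with hψ
  have hψ2 : ContDiffAt ℝ 2 ψ p :=
    contDiffAt_id.add ((hρ.sub (innerSL ℝ v).contDiff.contDiffAt).smul contDiffAt_const)
  set L : E →L[ℝ] E := ContinuousLinearMap.id ℝ E + (fderiv ℝ ρ p - innerSL ℝ v).smulRight v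
  have hL : HasFDerivAt ψ L p := by
    have hρ' := (hρ.differentiableAt two_ne_zero).hasFDerivAt
    exact (hasFDerivAt_id p).add ((hρ'.sub (innerSL ℝ v).hasFDerivAt).smul_const v)
  have hker : ∀ u, L u = 0 → u = 0 := by
    intro u hu
    have hu' : u + (fderiv ℝ ρ p u - inner ℝ v u) • v = 0 := by simpa [L] using hu
    have h1 : fderiv ℝ ρ p u = 0 := by
      have := congrArg (inner ℝ v) hu'
      rw [inner_add_right, real_inner_smul_right, hvv, inner_zero_right] at this
      linarith
    have h2 : inner ℝ v u = 0 := by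
      rw [hv, real_inner_smul_left, inner_gradient_left, h1, mul_zero]
    simpa [h1, h2] using hu'
  set e : E ≃L[ℝ] E := (LinearEquiv.ofInjectiveEndo (L : E →ₗ[ℝ] E)
    ((injective_iff_map_eq_zero _).2 hker)).toContinuousLinearEquiv
  have he : (e : E →L[ℝ] E) = L := by ext u; rfl
  have hL' : HasFDerivAt ψ (e : E →L[ℝ] E) p := he ▸ hL
  refine ⟨v, ψ, hψ2.localInverse hL' two_ne_zero, fun q => ?_, hv1, ?_⟩
  · simp only [hψ]
    rw [inner_add_right, real_inner_smul_right, hvv]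
    ring
  have hinv := (hψ2.hasStrictFDerivAt' hL' two_ne_zero).eventually_left_inverse
  have hφ := (hψ2.to_localInverse hL' two_ne_zero).eventually (by simp)
  have hcont : ∀ᶠ q in 𝓝 p, ContinuousAt ψ q :=
    (hψ2.eventually (by simp)).mono fun q hq => hq.continuousAt
  filter_upwards [hinv, hψ2.continuousAt.eventually hφ, hcont] with q h1 h2 h3
  exact ⟨h1, h2, h3⟩

end Calculus

section Focal

variable {E : Type*} [NormedAddCommGroup E] [InnerProductSpace ℝ E] [FiniteDimensional ℝ E]
  [MeasurableSpace E] [BorelSpace E]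

/-- Near each point of a `C²` boundary, the points of the cut locus off the medial axis whose
nearest boundary point lies there are critical values of the normal map, hence negligible. -/
lemma IsLocalDefiningFunction.exists_nhds_volume_eq_zero {Ω V : Set E} {p : E} {ρ : E → ℝ}
    (hK : IsCompact (frontier Ω)) (hp : p ∈ frontier Ω)
    (hloc : IsLocalDefiningFunction Ω 2 p V ρ) :
    ∃ U ∈ 𝓝 p, volume {x ∈ cutLocus Ω \ medialAxis Ω |
      ∃ y ∈ U ∩ frontier Ω, dist x y = infDist x (frontier Ω)} = 0 := by
  obtain ⟨hV, hpV, hρ, hgrad, -, hKV⟩ := hloc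
  have hρ' : ∀ q ∈ V, ContDiffAt ℝ 2 ρ q := fun q hq => hρ.contDiffAt (hV.mem_nhds hq)
  obtain ⟨v, ψ, φ, hψ, hv1, hev⟩ :=
    exists_straightening (hρ' p hpV) (hgrad p ⟨hpV, hp⟩)
  have hvv : inner ℝ v v = 1 := by rw [real_inner_self_eq_norm_sq, hv1, one_pow]
  set N := gradient ρ with hN
  set G : E → E := fun w => φ (w - inner ℝ v w • v) + inner ℝ v w • N (φ (w - inner ℝ v w • v))
    with hG
  set τ : E → E → ℝ := fun x y => inner ℝ (N y) (x - y) / ‖N y‖ ^ 2 with hτ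
  set W : E → E → E := fun x y => ψ y + τ x y • v with hW
  have hzero : ∀ y ∈ frontier Ω, y ∈ V → ρ y = 0 := fun y hy hyV =>
    ((Set.ext_iff.1 hKV y).1 ⟨hy, hyV⟩).2
  have hWv : ∀ x, ∀ y ∈ frontier Ω, y ∈ V → inner ℝ v (W x y) = τ x y := by
    intro x y hy hyV
    simp only [hW]
    rw [inner_add_right, real_inner_smul_right, hψ, hzero y hy hyV, hvv, zero_add, mul_one]
  have hWproj : ∀ x, ∀ y ∈ frontier Ω, y ∈ V → W x y - inner ℝ v (W x y) • v = ψ y := by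
    intro x y hy hyV
    rw [hWv x y hy hyV, hW, add_sub_cancel_right]
  have hGW : ∀ x, ∀ y ∈ frontier Ω, y ∈ V → φ (ψ y) = y →
      dist x y = infDist x (frontier Ω) → G (W x y) = x := by
    intro x y hy hyV hφ hxy
    simp only [hG]
    rw [hWproj x y hy hyV, hφ, hWv x y hy hyV]
    have := sub_eq_smul_gradient_of_dist_eq_infDist hV hKV hyV hy
      ((hρ' y hyV).of_le one_le_two) (hgrad y ⟨hyV, hy⟩) hxy
    rw [← this, add_sub_cancel]
  refine ⟨_, eventually_eventually_nhds.2 (hev.and (hV.eventually_mem hpV)), ?_⟩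
  refine measure_mono_null (t := G '' {w | DifferentiableAt ℝ G w ∧ (fderiv ℝ G w).det = 0}) ?_
    (addHaar_image_eq_zero_of_det_fderivWithin_eq_zero volume
      (fun w hw => hw.1.hasFDerivAt.hasFDerivWithinAt) fun w hw => hw.2)
  rintro x ⟨⟨⟨hcl, hxΩ⟩, hxM⟩, y, ⟨hyU, hy⟩, hxy⟩
  have hyU' : ∀ᶠ q in 𝓝 y, (φ (ψ q) = q ∧ ContDiffAt ℝ 2 φ (ψ q) ∧ ContinuousAt ψ q) ∧ q ∈ V :=
    hyU
  obtain ⟨⟨hφy, hφC, hψc⟩, hyV⟩ := hyU'.self_of_nhds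
  have hNy : N y ≠ 0 := by simpa [hN, gradient] using hgrad y ⟨hyV, hy⟩
  have hvC : ContDiffAt ℝ 1 (fun w => inner ℝ v w) (W x y) := (innerSL ℝ v).contDiff.contDiffAt
  have hGC : ContDiffAt ℝ 1 G (W x y) := by
    have hproj : ContDiffAt ℝ 1 (fun w : E => φ (w - inner ℝ v w • v)) (W x y) := by
      refine ContDiffAt.comp (W x y) (g := φ) ?_
        (contDiffAt_id.sub (hvC.smul contDiffAt_const))
      rw [hWproj x y hy hyV]
      exact hφC.of_le one_le_two
    have hNC : ContDiffAt ℝ 1 (fun w : E => N (φ (w - inner ℝ v w • v))) (W x y) := by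
      refine ContDiffAt.comp (W x y) (g := N) ?_ hproj
      rw [hWproj x y hy hyV, hφy]
      exact (hρ' y hyV).gradient
    exact hproj.add (hvC.smul hNC)
  refine ⟨W x y, ⟨hGC.differentiableAt one_ne_zero, ?_⟩, hGW x y hy hyV hφy hxy⟩
  obtain ⟨u, hu, hux⟩ := mem_closure_iff_seq_limit.1 hcl
  choose _ a ha b hb hab hua hub using hu
  have huniq : ∀ y' ∈ frontier Ω, dist x y' = infDist x (frontier Ω) → y' = y := by
    intro y' hy' hxy'
    by_contra hne
    exact hxM ⟨hxΩ, y', hy', y, hy, hne, hxy', hxy⟩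
  have hay := tendsto_nearest_point hK hux ha hua huniq
  have hby := tendsto_nearest_point hK hux hb hub huniq
  have hWlim : ∀ c : ℕ → E, Tendsto c atTop (𝓝 y) →
      Tendsto (fun n => W (u n) (c n)) atTop (𝓝 (W x y)) := by
    intro c hc
    have hNc : Tendsto (fun n => N (c n)) atTop (𝓝 (N y)) :=
      (hρ' y hyV).gradient.continuousAt.tendsto.comp hc
    have hτc : Tendsto (fun n => τ (u n) (c n)) atTop (𝓝 (τ x y)) :=
      (hNc.inner (hux.sub hc)).div (hNc.norm.pow 2) (by simpa using hNy)
    exact (hψc.tendsto.comp hc).add (hτc.smul_const v)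
  refine (hGC.hasStrictFDerivAt one_ne_zero).det_eq_zero_of_tendsto (hWlim a hay) (hWlim b hby) ?_
  filter_upwards [hay.eventually hyU', hby.eventually hyU'] with n han hbn
  refine ⟨fun heq => hab n ?_, ?_⟩
  · have := hWproj (u n) (a n) (ha n) han.2
    rw [heq, hWproj (u n) (b n) (hb n) hbn.2] at this
    rw [← han.1.1, ← hbn.1.1, this]
  · rw [hGW _ _ (ha n) han.2 han.1.1 (hua n), hGW _ _ (hb n) hbn.2 hbn.1.1 (hub n)]

lemma volume_cutLocus_diff_medialAxis {Ω : Set E} (hbdd : Bornology.IsBounded Ω)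
    (hC2 : HasCkBoundary Ω 2) : volume (cutLocus Ω \ medialAxis Ω) = 0 := by
  have hK : IsCompact (frontier Ω) :=
    isCompact_of_isClosed_isBounded isClosed_frontier
      (hbdd.closure.subset frontier_subset_closure)
  have hall : volume {x ∈ cutLocus Ω \ medialAxis Ω |
      ∃ y ∈ frontier Ω ∩ frontier Ω, dist x y = infDist x (frontier Ω)} = 0 := by
    refine hK.induction_on (p := fun T => volume {x ∈ cutLocus Ω \ medialAxis Ω |
      ∃ y ∈ T ∩ frontier Ω, dist x y = infDist x (frontier Ω)} = 0) (by simp) ?_ ?_ ?_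
    · rintro s t hst ht
      refine measure_mono_null ?_ ht
      rintro x ⟨hx, y, ⟨hys, hy⟩, hxy⟩
      exact ⟨hx, y, ⟨hst hys, hy⟩, hxy⟩
    · rintro s t hs ht
      refine measure_mono_null ?_ (measure_union_null hs ht)
      rintro x ⟨hx, y, ⟨hys | hyt, hy⟩, hxy⟩
      · exact Or.inl ⟨hx, y, ⟨hys, hy⟩, hxy⟩
      · exact Or.inr ⟨hx, y, ⟨hyt, hy⟩, hxy⟩
    · intro p hp
      obtain ⟨V, ρ, hloc⟩ := hC2 p hp
      obtain ⟨U, hU, h0⟩ := hloc.exists_nhds_volume_eq_zero hK hp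
      exact ⟨U, mem_nhdsWithin_of_mem_nhds hU, h0⟩
  refine measure_mono_null ?_ hall
  intro x hx
  have hne : (frontier Ω).Nonempty := by
    obtain ⟨z, -, y, hy, -⟩ := closure_nonempty_iff.1 ⟨x, hx.1.1⟩
    exact ⟨y, hy⟩
  obtain ⟨y, hy, hxy⟩ := hK.exists_infDist_eq_dist hne x
  exact ⟨hx, y, ⟨hy, hy⟩, hxy.symm⟩

end Focal

/-- Theorem (statement 17, Crasta–Malusa): if `Ω ⊆ ℝᵐ` is a bounded domain with `C²`-smooth
boundary, then the cut locus `Σ` of `Ω` has Lebesgue measure zero. -/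
theorem cutLocus_measure_zero (m : ℕ) (Ω : Set (EuclideanSpace ℝ (Fin m)))
    (hopen : IsOpen Ω) (hconn : IsConnected Ω) (hbdd : Bornology.IsBounded Ω)
    (hC2 : HasCkBoundary Ω 2) :
    volume (cutLocus Ω) = 0 := by
  refine measure_mono_null (t := medialAxis Ω ∪ cutLocus Ω \ medialAxis Ω) ?_
    (measure_union_null (volume_medialAxis Ω) (volume_cutLocus_diff_medialAxis hbdd hC2))
  rw [union_sdiff_self]
  exact subset_union_right

end
end

section
/- Let Ω ⊂ ℝ^m be a bounded domain whose boundary is C^{1,1}-smooth. Then the medial axis Γ of Ω is relatively compact in Ω; that is, the closure of Γ is a compact subset of Ω. -/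
open MeasureTheory Metric Filter Topology Set
open scoped ENNReal

noncomputable section

/-- `Ω` has `C^{1,1}`-smooth boundary: every boundary point admits a local defining function
which is `C¹` with Lipschitz gradient on its (open) domain of definition. -/
def HasC11Boundary {F : Type*} [NormedAddCommGroup F] [NormedSpace ℝ F]
    (Ω : Set F) : Prop :=
  ∀ p ∈ frontier Ω, ∃ (V : Set F) (ρ : F → ℝ) (L : NNReal),
    IsOpen V ∧ p ∈ V ∧ ContDiffOn ℝ 1 ρ V ∧
      LipschitzOnWith L (fun q => fderiv ℝ ρ q) V ∧
      (∀ q ∈ V ∩ frontier Ω, fderiv ℝ ρ q ≠ 0) ∧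
      Ω ∩ V = {q | q ∈ V ∧ ρ q < 0} ∧ frontier Ω ∩ V = {q | q ∈ V ∧ ρ q = 0}

/-- If `y` is a nearest point to `x` on a regular level set of `ρ`, then the derivative of `ρ`
at `y` is a multiple of the inner product with `y - x`. -/
theorem exists_fderiv_eq_smul_innerSL_of_nearest {F : Type*} [NormedAddCommGroup F]
    [InnerProductSpace ℝ F] [CompleteSpace F] {ρ : F → ℝ} {x y : F} (hρ : ContDiffAt ℝ 1 ρ y)
    (hxy : x ≠ y) (hmin : ∀ᶠ q in 𝓝 y, ρ q = ρ y → dist x y ≤ dist x q) :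
    ∃ c : ℝ, fderiv ℝ ρ y = c • innerSL ℝ (y - x) := by
  have hφ : HasStrictFDerivAt (fun q : F => ‖q - x‖ ^ 2) (2 • innerSL ℝ (y - x)) y := by
    simpa using (hasStrictFDerivAt_norm_sq (y - x)).comp y
      ((hasStrictFDerivAt_id y).sub_const x)
  have hext : IsLocalExtrOn (fun q : F => ‖q - x‖ ^ 2) {q | ρ q = ρ y} y := by
    refine Or.inl (eventually_nhdsWithin_iff.mpr (hmin.mono fun q hq hqy => ?_))
    have h := hq hqy
    rw [dist_comm x y, dist_comm x q, dist_eq_norm, dist_eq_norm] at h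
    dsimp only
    gcongr
  obtain ⟨a, b, hab, h⟩ := hext.exists_multipliers_of_hasStrictFDerivAt_1d
    (hρ.hasStrictFDerivAt one_ne_zero) hφ
  have ha : a ≠ 0 := by
    rintro rfl
    have hb : b ≠ 0 := by rintro rfl; exact hab rfl
    have h' : innerSL ℝ (y - x) = 0 := by
      rw [← Nat.cast_smul_eq_nsmul ℝ] at h
      simpa [hb, -map_sub] using h
    have h_norm := congrArg norm h'
    rw [innerSL_apply_norm, norm_zero, norm_eq_zero, sub_eq_zero] at h_norm
    exact hxy h_norm.symm
  refine ⟨-(a⁻¹ * b * 2), ?_⟩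
  ext v
  have h' := congrArg (fun l : F →L[ℝ] ℝ => l v) h
  simp at h' ⊢
  field_simp
  linarith

/-- If the derivative of `ρ` is `L`-Lipschitz on a convex set containing two distinct points `y`,
`z` of a level set of `ρ` equidistant from `x`, and the derivative at `y` is normal to the sphere
around `x`, then the norm of that derivative is at most `2 * L` times the radius. -/
theorem norm_fderiv_le_of_equidistant {F : Type*} [NormedAddCommGroup F]
    [InnerProductSpace ℝ F] {ρ : F → ℝ} {s : Set F} {L : NNReal} {x y z : F} {c : ℝ}
    (hs : Convex ℝ s) (hρ : ∀ q ∈ s, DifferentiableAt ℝ ρ q)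
    (hL : LipschitzOnWith L (fun q => fderiv ℝ ρ q) s) (hy : y ∈ s) (hz : z ∈ s) (hyz : y ≠ z)
    (hval : ρ y = ρ z) (hdist : dist x y = dist x z)
    (hc : fderiv ℝ ρ y = c • innerSL ℝ (y - x)) :
    ‖fderiv ℝ ρ y‖ ≤ 2 * L * dist x y := by
  have hseg : segment ℝ y z ⊆ s := hs.segment_subset hy hz
  have htaylor := (convex_segment (𝕜 := ℝ) y z).norm_image_sub_le_of_norm_fderiv_le'
    (f := ρ) (φ := fderiv ℝ ρ y) (C := L * ‖z - y‖) (fun q hq => hρ q (hseg hq))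
    (fun q hq => by
      refine (hL.norm_sub_le (hseg hq) hy).trans ?_
      gcongr
      obtain ⟨t, ⟨ht0, ht1⟩, rfl⟩ := (segment_eq_image' ℝ y z) ▸ hq
      rw [add_sub_cancel_left, norm_smul, Real.norm_of_nonneg ht0]
      exact mul_le_of_le_one_left (norm_nonneg _) ht1)
    (left_mem_segment ℝ y z) (right_mem_segment ℝ y z)
  have hpyth : ‖z - x‖ ^ 2 = ‖y - x‖ ^ 2 + 2 * inner ℝ (y - x) (z - y) + ‖z - y‖ ^ 2 := by
    rw [← norm_add_sq_real, sub_add_sub_cancel']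
  rw [dist_comm x y, dist_comm x z, dist_eq_norm, dist_eq_norm] at hdist
  have hinner : inner ℝ (y - x) (z - y) = -(‖z - y‖ ^ 2 / 2) := by
    rw [hdist] at hpyth
    linarith
  have hpos : 0 < ‖z - y‖ := norm_pos_iff.mpr (sub_ne_zero.mpr hyz.symm)
  have hcL : |c| ≤ 2 * L := by
    rw [hval, sub_self, zero_sub, norm_neg, hc, smul_apply,
      innerSL_apply_apply, hinner, norm_smul, norm_neg, Real.norm_eq_abs,
      Real.norm_of_nonneg (by positivity : 0 ≤ ‖z - y‖ ^ 2 / 2)] at htaylor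
    refine le_of_mul_le_mul_right ?_ (pow_pos hpos 2)
    linarith
  rw [hc, norm_smul, innerSL_apply_norm, Real.norm_eq_abs, dist_comm, dist_eq_norm]
  gcongr

/-- Boundary points near which the boundary is `C^{1,1}` are not limits of the medial axis. -/
theorem notMem_closure_medialAxis_of_mem_frontier {F : Type*} [NormedAddCommGroup F]
    [InnerProductSpace ℝ F] [CompleteSpace F] {Ω : Set F} (hopen : IsOpen Ω)
    (hC11 : HasC11Boundary Ω) {p : F} (hp : p ∈ frontier Ω) : p ∉ closure (medialAxis Ω) := by
  obtain ⟨V, ρ, L, hV, hpV, hρ, hL, hne, -, hfr⟩ := hC11 p hp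
  have hgrad : 0 < ‖fderiv ℝ ρ p‖ := norm_pos_iff.mpr (hne p ⟨hpV, hp⟩)
  have hcont : ContinuousAt (fun q => ‖fderiv ℝ ρ q‖) p :=
    (hL.continuousOn.continuousAt (hV.mem_nhds hpV)).norm
  obtain ⟨r, hr, hball⟩ := Metric.mem_nhds_iff.mp (Filter.inter_mem (hV.mem_nhds hpV)
    (hcont.eventually (lt_mem_nhds (half_lt_self hgrad))))
  have hballV : ball p r ⊆ V := fun q hq => (hball hq).1
  intro hmem
  have hsmall : ∀ᶠ δ in 𝓝[>] (0 : ℝ), 2 * δ < r ∧ 2 * L * δ < ‖fderiv ℝ ρ p‖ / 2 := by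
    refine nhdsWithin_le_nhds (Filter.Eventually.and ?_ ?_)
    · exact (by fun_prop : Continuous fun δ : ℝ => 2 * δ).continuousAt.eventually_lt
        continuousAt_const (by simpa using hr)
    · exact (by fun_prop : Continuous fun δ : ℝ => 2 * L * δ).continuousAt.eventually_lt
        continuousAt_const (by simpa using hgrad)
  obtain ⟨δ, ⟨hδr, hδL⟩, hδ⟩ := (hsmall.and self_mem_nhdsWithin).exists
  obtain ⟨x, ⟨hxΩ, y, hy, z, hz, hyz, hxy, hxz⟩, hpx⟩ := Metric.mem_closure_iff.mp hmem δ hδ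
  have hd : infDist x (frontier Ω) ≤ dist p x := dist_comm p x ▸ infDist_le_dist_of_mem hp
  have hnear : ∀ w, dist x w = infDist x (frontier Ω) → w ∈ ball p r := fun w hw => by
    rw [mem_ball, dist_comm]
    linarith [dist_triangle p x w]
  have hyV := hnear y hxy
  have hzV := hnear z hxz
  have hρ0 : ∀ w ∈ frontier Ω, w ∈ ball p r → ρ w = 0 := fun w hw hwr =>
    (hfr.subset ⟨hw, hballV hwr⟩).2
  have hdiff : ∀ q ∈ ball p r, ContDiffAt ℝ 1 ρ q := fun q hq =>
    hρ.contDiffAt (hV.mem_nhds (hballV hq))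
  have hne_xy : x ≠ y := by
    rintro rfl
    exact (hopen.frontier_eq ▸ hy).2 hxΩ
  obtain ⟨c, hc⟩ := exists_fderiv_eq_smul_innerSL_of_nearest (hdiff y hyV) hne_xy
    (Filter.mem_of_superset (hV.mem_nhds (hballV hyV)) fun q hq hqy => hxy ▸
      infDist_le_dist_of_mem (hfr.superset ⟨hq, hqy.trans (hρ0 y hy hyV)⟩).1)
  have hbound := norm_fderiv_le_of_equidistant (convex_ball p r)
    (fun q hq => (hdiff q hq).differentiableAt one_ne_zero) (hL.mono hballV) hyV hzV hyz
    ((hρ0 y hy hyV).trans (hρ0 z hz hzV).symm) (hxy.trans hxz.symm) hc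
  have hlower : ‖fderiv ℝ ρ p‖ / 2 < ‖fderiv ℝ ρ y‖ := (hball hyV).2
  have hupper : 2 * (L : ℝ) * dist x y ≤ 2 * L * δ := by
    gcongr
    linarith
  linarith

/-- Theorem (statement 18): if `Ω ⊆ ℝᵐ` is a bounded domain with `C^{1,1}`-smooth boundary,
then the medial axis `Γ` of `Ω` is relatively compact in `Ω`: its closure is a compact subset
of `Ω`. -/
theorem medialAxis_relatively_compact (m : ℕ) (Ω : Set (EuclideanSpace ℝ (Fin m)))
    (hopen : IsOpen Ω) (hconn : IsConnected Ω) (hbdd : Bornology.IsBounded Ω)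
    (hC11 : HasC11Boundary Ω) :
    IsCompact (closure (medialAxis Ω)) ∧ closure (medialAxis Ω) ⊆ Ω := by
  refine ⟨(hbdd.subset fun x hx => hx.1).isCompact_closure, fun p hp => ?_⟩
  by_contra hpΩ
  have hpcl : p ∈ closure Ω := closure_mono (fun x hx => hx.1) hp
  exact notMem_closure_medialAxis_of_mem_frontier hopen hC11
    (hopen.frontier_eq ▸ ⟨hpcl, hpΩ⟩) hp

end
end
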